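/- arXiv:2211.06540 — 7 statements merged into one kernel-verified Lean document; each statement's English description precedes it below -/
import Mathlib

section
/- Let p : ℕ → (0,1) be a function with limsup_{n→∞} p(n) < 1/4. Then asymptotically almost surely (i.e., with probability tending to 1 as n → ∞) every orientation of the binomial random graph G(n, p(n)) contains a Seymour vertex. -/
/-- `D` is an orientation of the simple graph `G`: every arc of `D` lies on an edge of `G`,
and every edge of `G` is given exactly one of its two possible directions. -/
def IsOrientation {V : Type*} (G : SimpleGraph V) (D : V → V → Prop) : Prop :=
  (∀ u v, D u v → G.Adj u v) ∧ ∀ u v, G.Adj u v → (D u v ↔ ¬ D v u)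

/-- The first neighborhood (out-neighborhood) of `u` in the digraph `D`. -/
def firstNbhd {V : Type*} (D : V → V → Prop) (u : V) : Set V := {v | D u v}

/-- The second neighborhood of `u`: vertices whose shortest directed path from `u`
has exactly two arcs. -/
def secondNbhd {V : Type*} (D : V → V → Prop) (u : V) : Set V :=
  {v | ¬ D u v ∧ v ≠ u ∧ ∃ w, D u w ∧ D w v}

/-- A Seymour vertex: its second neighborhood is at least as large as its first. -/
def IsSeymourVertex {V : Type*} (D : V → V → Prop) (u : V) : Prop :=
  (firstNbhd D u).ncard ≤ (secondNbhd D u).ncard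

/-- The digraph `D` contains a Seymour vertex. -/
def HasSeymourVertex {V : Type*} (D : V → V → Prop) : Prop :=
  ∃ u, IsSeymourVertex D u

/- The probability that the binomial random graph `G(n,p)` belongs to the set `S`:
each graph `G` on `{1,…,n}` receives probability `p^{e(G)} (1-p)^{C(n,2)-e(G)}`. -/
open scoped Classical in
noncomputable def gnpProb (n : ℕ) (p : ℝ) (S : Set (SimpleGraph (Fin n))) : ℝ :=
  ∑ G : SimpleGraph (Fin n),
    if G ∈ S then p ^ G.edgeSet.ncard * (1 - p) ^ (n.choose 2 - G.edgeSet.ncard) else 0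

namespace SNC

open Finset

noncomputable section

open scoped Classical

/-- weight of a graph -/
def wt (n : ℕ) (p : ℝ) (G : SimpleGraph (Fin n)) : ℝ :=
  p ^ G.edgeSet.ncard * (1 - p) ^ (n.choose 2 - G.edgeSet.ncard)

/-- number of edges of `G` in `F` -/
def cnt {n : ℕ} (G : SimpleGraph (Fin n)) (F : Finset (Sym2 (Fin n))) : ℕ :=
  (F.filter (fun e => e ∈ G.edgeSet)).card

/-- pairs joining `A` and `X` -/
def FF {n : ℕ} (A X : Finset (Fin n)) : Finset (Sym2 (Fin n)) :=
  ((A ×ˢ X).image (fun q => s(q.1, q.2))).filter (fun e => ¬ e.IsDiag)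

lemma gnpProb_eq (n : ℕ) (p : ℝ) (S : Set (SimpleGraph (Fin n))) :
    gnpProb n p S = ∑ G : SimpleGraph (Fin n), if G ∈ S then wt n p G else 0 := by
  unfold gnpProb wt
  rfl

lemma wt_nonneg (n : ℕ) (p : ℝ) (h0 : 0 ≤ p) (h1 : p ≤ 1) (G) : 0 ≤ wt n p G := by
  unfold wt
  have : 0 ≤ 1 - p := by linarith
  positivity

lemma moment (n : ℕ) (p t : ℝ) (F : Finset (Sym2 (Fin n))) (hF : ∀ e ∈ F, ¬ e.IsDiag) :
    ∑ G : SimpleGraph (Fin n), wt n p G * t ^ cnt G F = (1 + p * (t - 1)) ^ F.card := by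
  set E : Finset (Sym2 (Fin n)) := (⊤ : SimpleGraph (Fin n)).edgeFinset with hE
  have hmem : ∀ e, e ∈ E ↔ ¬ e.IsDiag := by
    intro e
    simp [hE]
  have hEcard : E.card = n.choose 2 := by
    rw [hE, SimpleGraph.card_edgeFinset_top_eq_card_choose_two, Fintype.card_fin]
  have hFE : F ⊆ E := fun e he => (hmem e).2 (hF e he)
  have key := Finset.prod_add (fun e => p * (if e ∈ F then t else 1)) (fun _ => 1 - p) E
  have hL : ∏ e ∈ E, (p * (if e ∈ F then t else 1) + (1 - p)) = (1 + p * (t - 1)) ^ F.card := by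
    rw [← Finset.prod_sdiff hFE]
    rw [Finset.prod_eq_one (s := E \ F), Finset.prod_congr rfl (g := fun _ => 1 + p * (t - 1))]
    · simp
    · intro e he
      simp [he]; ring
    · intro e he
      simp [(Finset.mem_sdiff.1 he).2]
  rw [← hL, key]
  refine Finset.sum_bij' (fun G _ => G.edgeFinset) (fun s _ => SimpleGraph.fromEdgeSet (s : Set (Sym2 (Fin n)))) ?_ ?_ ?_ ?_ ?_
  · intro G _
    rw [Finset.mem_powerset]
    intro e he
    rw [hmem]
    exact G.not_isDiag_of_mem_edgeFinset he
  · intros; simp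
  · intro G _
    simp
  · intro s hs
    ext e
    simp only [SimpleGraph.mem_edgeFinset, SimpleGraph.edgeSet_fromEdgeSet]
    constructor
    · intro h; exact h.1
    · intro h
      refine ⟨h, ?_⟩
      have := (hmem e).1 (Finset.mem_powerset.1 hs h)
      simpa using this
  · intro G _
    have hsub : G.edgeFinset ⊆ E := by
      intro e he
      rw [hmem]
      exact G.not_isDiag_of_mem_edgeFinset he
    have hc : G.edgeSet.ncard = G.edgeFinset.card := by
      rw [← SimpleGraph.coe_edgeFinset, Set.ncard_coe_finset]
    rw [Finset.prod_mul_distrib, Finset.prod_const, Finset.prod_const, Finset.card_sdiff_of_subset hsub,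
      hEcard, ← Finset.prod_filter, Finset.prod_const]
    unfold wt cnt
    rw [hc]
    have : (F.filter (fun e => e ∈ G.edgeSet)) = G.edgeFinset.filter (fun e => e ∈ F) := by
      ext e; simp [and_comm]
    rw [this]
    ring

lemma FF_nd {n : ℕ} (A X : Finset (Fin n)) : ∀ e ∈ FF A X, ¬ e.IsDiag := by
  intro e he
  exact (Finset.mem_filter.1 he).2

lemma FF_card_le {n : ℕ} (A X : Finset (Fin n)) : (FF A X).card ≤ A.card * X.card := by
  unfold FF
  refine (Finset.card_filter_le _ _).trans (Finset.card_image_le.trans ?_)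
  rw [Finset.card_product]

lemma FF_card_disj {n : ℕ} (A X : Finset (Fin n)) (h : Disjoint A X) :
    (FF A X).card = A.card * X.card := by
  unfold FF
  rw [Finset.filter_true_of_mem, Finset.card_image_of_injOn, Finset.card_product]
  · rintro ⟨a, b⟩ hab ⟨c, d⟩ hcd heq
    simp only [Finset.coe_product, Set.mem_prod, Finset.mem_coe] at hab hcd
    simp only [Sym2.eq_iff] at heq
    rcases heq with ⟨h1, h2⟩ | ⟨h1, h2⟩
    · simp [h1, h2]
    · exact absurd (h1 ▸ hab.1) (fun h' => Finset.disjoint_left.1 h h' hcd.2)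
  · intro e he
    obtain ⟨⟨a, b⟩, hab, rfl⟩ := Finset.mem_image.1 he
    simp only [Finset.mem_product] at hab
    simp only [Sym2.mk_isDiag_iff]
    rintro rfl
    exact Finset.disjoint_left.1 h hab.1 hab.2

lemma prob_nonneg {n : ℕ} {p : ℝ} (h0 : 0 ≤ p) (h1 : p ≤ 1) (S : Set (SimpleGraph (Fin n))) :
    0 ≤ gnpProb n p S := by
  rw [gnpProb_eq]
  refine Finset.sum_nonneg fun G _ => ?_
  split_ifs
  · exact wt_nonneg n p h0 h1 G
  · exact le_rfl

lemma prob_mono {n : ℕ} {p : ℝ} (h0 : 0 ≤ p) (h1 : p ≤ 1) {S T : Set (SimpleGraph (Fin n))}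
    (h : S ⊆ T) : gnpProb n p S ≤ gnpProb n p T := by
  rw [gnpProb_eq, gnpProb_eq]
  refine Finset.sum_le_sum fun G _ => ?_
  have := wt_nonneg n p h0 h1 G
  by_cases hG : G ∈ S
  · simp [hG, h hG]
  · simp only [hG, if_false]
    split_ifs <;> simp [this]

lemma prob_union {n : ℕ} {p : ℝ} (h0 : 0 ≤ p) (h1 : p ≤ 1) (S T : Set (SimpleGraph (Fin n))) :
    gnpProb n p (S ∪ T) ≤ gnpProb n p S + gnpProb n p T := by
  simp only [gnpProb_eq]
  rw [← Finset.sum_add_distrib]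
  refine Finset.sum_le_sum fun G _ => ?_
  have := wt_nonneg n p h0 h1 G
  by_cases hG : G ∈ S <;> by_cases hG' : G ∈ T <;> simp [hG, hG', this]

lemma prob_biUnion {n : ℕ} {p : ℝ} (h0 : 0 ≤ p) (h1 : p ≤ 1) {ι : Type*} (I : Finset ι)
    (S : ι → Set (SimpleGraph (Fin n))) :
    gnpProb n p {G | ∃ i ∈ I, G ∈ S i} ≤ ∑ i ∈ I, gnpProb n p (S i) := by
  simp only [gnpProb_eq]
  rw [Finset.sum_comm]
  refine Finset.sum_le_sum fun G _ => ?_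
  have hw := wt_nonneg n p h0 h1 G
  have hnn : ∀ i ∈ I, 0 ≤ (if G ∈ S i then wt n p G else 0) := by
    intro i _; split_ifs <;> simp [hw]
  by_cases hG : ∃ i ∈ I, G ∈ S i
  · obtain ⟨i, hi, hGi⟩ := hG
    have h2 := Finset.single_le_sum hnn hi
    simp only [hGi, if_true] at h2
    rw [if_pos (show G ∈ {G | ∃ i ∈ I, G ∈ S i} from ⟨i, hi, hGi⟩)]
    exact h2
  · rw [if_neg (show ¬ G ∈ {G | ∃ i ∈ I, G ∈ S i} from hG)]
    exact Finset.sum_nonneg hnn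

lemma prob_compl {n : ℕ} {p : ℝ} (S : Set (SimpleGraph (Fin n))) :
    gnpProb n p S + gnpProb n p Sᶜ = 1 := by
  have h := moment n p 1 ∅ (by simp)
  simp only [one_pow, mul_one, Finset.card_empty, pow_zero] at h
  rw [← h]
  simp only [gnpProb_eq]
  rw [← Finset.sum_add_distrib]
  refine Finset.sum_congr rfl fun G _ => ?_
  by_cases hG : G ∈ S <;> simp [hG]

lemma markov {n : ℕ} {p : ℝ} (h0 : 0 ≤ p) (h1 : p ≤ 1) {t c : ℝ} (ht : 0 ≤ t)
    (F : Finset (Sym2 (Fin n))) (hF : ∀ e ∈ F, ¬ e.IsDiag) (S : Set (SimpleGraph (Fin n)))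
    (hS : ∀ G ∈ S, c ≤ t ^ cnt G F) :
    gnpProb n p S * c ≤ (1 + p * (t - 1)) ^ F.card := by
  rw [← moment n p t F hF, gnpProb_eq, Finset.sum_mul]
  refine Finset.sum_le_sum fun G _ => ?_
  have hw := wt_nonneg n p h0 h1 G
  by_cases hG : G ∈ S
  · simp only [hG, if_true]
    exact mul_le_mul_of_nonneg_left (hS G hG) hw
  · simp only [hG, if_false, zero_mul]
    positivity

/-- crude upper tail -/
lemma upper_tail {n : ℕ} {p : ℝ} (h0 : 0 < p) (h1 : p ≤ 1)
    (F : Finset (Sym2 (Fin n))) (hF : ∀ e ∈ F, ¬ e.IsDiag) (k M : ℕ) (hM : F.card ≤ M) :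
    gnpProb n p {G | k ≤ cnt G F} ≤ 2 ^ M * p ^ k := by
  have h := markov (n := n) h0.le h1 (t := p⁻¹) (c := p⁻¹ ^ k) (by positivity) F hF {G | k ≤ cnt G F} (by
    intro G hG
    exact pow_le_pow_right₀ ((one_le_inv₀ h0).2 h1) hG)
  have h2 : (1 + p * (p⁻¹ - 1)) ^ F.card ≤ 2 ^ M := by
    have : 1 + p * (p⁻¹ - 1) = 2 - p := by field_simp; ring
    rw [this]
    calc (2 - p) ^ F.card ≤ 2 ^ F.card := pow_le_pow_left₀ (by linarith) (by linarith) _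
      _ ≤ 2 ^ M := pow_le_pow_right₀ (by norm_num) hM
  have h3 := h.trans h2
  have hpk : 0 < p ^ k := by positivity
  rw [inv_pow, ← div_eq_mul_inv, div_le_iff₀ hpk] at h3
  exact h3

lemma lower_tail {n : ℕ} {p : ℝ} (h0 : 0 < p) (h1 : p ≤ 1)
    (F : Finset (Sym2 (Fin n))) (hF : ∀ e ∈ F, ¬ e.IsDiag) :
    gnpProb n p {G | (cnt G F : ℝ) < p * F.card / 4} ≤ Real.exp (-(p * F.card / 4)) := by
  have h := markov (n := n) h0.le h1 (t := 1 / 2) (c := Real.exp (-(p * F.card / 4))) (by positivity) F hF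
    {G | (cnt G F : ℝ) < p * F.card / 4} (by
    intro G hG
    have hG' : (cnt G F : ℝ) < p * F.card / 4 := hG
    have e1 : Real.exp (-1) ≤ 1 / 2 := by
      rw [Real.exp_neg, one_div]
      apply inv_anti₀ (by norm_num)
      have := Real.add_one_le_exp (1:ℝ)
      linarith
    calc Real.exp (-(p * F.card / 4)) ≤ Real.exp (-(cnt G F : ℝ)) := Real.exp_le_exp.2 (by linarith)
      _ = Real.exp (-1) ^ cnt G F := by rw [← Real.exp_nat_mul]; ring_nf
      _ ≤ (1 / 2) ^ cnt G F := pow_le_pow_left₀ (Real.exp_pos _).le e1 _)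
  have h2 : (1 + p * (1 / 2 - 1)) ^ F.card ≤ Real.exp (-(p * F.card / 4)) * Real.exp (-(p * F.card / 4)) := by
    rw [← Real.exp_add]
    calc (1 + p * (1 / 2 - 1)) ^ F.card ≤ Real.exp (- (p / 2)) ^ F.card := by
          apply pow_le_pow_left₀ (by linarith)
          have := Real.add_one_le_exp (-(p/2))
          linarith
      _ = _ := by rw [← Real.exp_nat_mul]; ring_nf
  have hpos := Real.exp_pos (-(p * F.card / 4))
  exact le_of_mul_le_mul_right (h.trans h2) hpos

/-- the upper bad event -/
def UE (n a m k : ℕ) : Set (SimpleGraph (Fin n)) :=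
  {G | ∃ X A : Finset (Fin n), A ⊆ X ∧ A.card ≤ a ∧ X.card ≤ m ∧ k ≤ cnt G (FF A X)}

lemma card_small (n m : ℕ) :
    ((univ : Finset (Finset (Fin n))).filter (fun X => X.card ≤ m)).card ≤ (n + 1) ^ m := by
  induction m with
  | zero =>
    simp only [Nat.le_zero, Finset.card_eq_zero, pow_zero]
    rw [Finset.card_le_one]
    simp
  | succ m ih =>
    have hsub : ((univ : Finset (Finset (Fin n))).filter (fun X => X.card ≤ m + 1)) ⊆
        ((univ : Finset (Option (Fin n))) ×ˢ
          ((univ : Finset (Finset (Fin n))).filter (fun X => X.card ≤ m))).image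
          (fun q => q.1.elim q.2 (fun x => insert x q.2)) := by
      intro X hX
      simp only [Finset.mem_filter, Finset.mem_univ, true_and] at hX
      rw [Finset.mem_image]
      rcases X.eq_empty_or_nonempty with rfl | ⟨x, hx⟩
      · exact ⟨(none, ∅), by simp, by simp⟩
      · refine ⟨(some x, X.erase x), ?_, ?_⟩
        · simp [Finset.card_erase_of_mem hx]; omega
        · simp [Finset.insert_erase hx]
    refine (Finset.card_le_card hsub).trans (Finset.card_image_le.trans ?_)
    rw [Finset.card_product, Finset.card_univ, Fintype.card_option, Fintype.card_fin, pow_succ, mul_comm]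
    exact Nat.mul_le_mul_right _ ih

lemma UE_prob {n : ℕ} (hn : 1 ≤ n) {p : ℝ} (h0 : 0 < p) (h1 : p ≤ 1) (a m k : ℕ) :
    gnpProb n p (UE n a m k) ≤ (4 * n) ^ m * 2 ^ (a * m) * p ^ k := by
  set I := ((univ : Finset (Finset (Fin n))).filter (fun X => X.card ≤ m)) with hI
  set J : Finset (Finset (Fin n) × Finset (Fin n)) :=
    (I.sigma (fun X => X.powerset)).image (fun q => (q.1, q.2)) with hJ
  have hJc : J.card ≤ (n + 1) ^ m * 2 ^ m := by
    refine Finset.card_image_le.trans ?_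
    rw [Finset.card_sigma]
    calc ∑ X ∈ I, X.powerset.card ≤ ∑ X ∈ I, 2 ^ m := by
          refine Finset.sum_le_sum fun X hX => ?_
          rw [Finset.card_powerset]
          exact Nat.pow_le_pow_right (by norm_num) (Finset.mem_filter.1 hX).2
      _ = I.card * 2 ^ m := by simp
      _ ≤ _ := Nat.mul_le_mul_right _ (card_small n m)
  set J' := J.filter (fun q => q.2.card ≤ a ∧ q.1.card ≤ m) with hJ'
  have hsub : UE n a m k ⊆ {G | ∃ q ∈ J', G ∈ {G | k ≤ cnt G (FF q.2 q.1)}} := by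
    rintro G ⟨X, A, hAX, hA, hX, hk⟩
    refine ⟨(X, A), ?_, hk⟩
    simp [hJ', hJ, hI, hAX, hA, hX]
  have b1 := (prob_mono h0.le h1 hsub).trans (prob_biUnion h0.le h1 J' _)
  refine b1.trans ?_
  have b2 : ∀ q ∈ J', gnpProb n p {G | k ≤ cnt G (FF q.2 q.1)} ≤ 2 ^ (a * m) * p ^ k := by
    intro q hq
    have hq' := (Finset.mem_filter.1 hq).2
    exact upper_tail h0 h1 _ (FF_nd _ _) _ _ ((FF_card_le _ _).trans (Nat.mul_le_mul hq'.1 hq'.2))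
  refine (Finset.sum_le_card_nsmul _ _ _ b2).trans ?_
  rw [nsmul_eq_mul]
  have hc : (J'.card : ℝ) ≤ (4 * n) ^ m := by
    have h3 : J'.card ≤ (4 * n) ^ m := by
      refine (Finset.card_filter_le _ _).trans (hJc.trans ?_)
      rw [← Nat.mul_pow]
      exact Nat.pow_le_pow_left (by omega) _
    exact_mod_cast h3
  rw [mul_assoc]
  exact mul_le_mul_of_nonneg_right hc (by positivity)

/-- lower bad event -/
def LEv (n : ℕ) (p : ℝ) : Set (SimpleGraph (Fin n)) :=
  {G | ∃ S T : Finset (Fin n), Disjoint S T ∧ 8 * n ≤ p * S.card * T.card ∧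
    (cnt G (FF S T) : ℝ) < p * S.card * T.card / 4}

lemma LEv_prob {n : ℕ} {p : ℝ} (h0 : 0 < p) (h1 : p ≤ 1) :
    gnpProb n p (LEv n p) ≤ (4 * Real.exp (-2)) ^ n := by
  set J := ((univ : Finset (Finset (Fin n) × Finset (Fin n)))).filter (fun q => Disjoint q.1 q.2 ∧
    8 * n ≤ p * q.1.card * q.2.card) with hJ
  have hsub : LEv n p ⊆ {G | ∃ q ∈ J, G ∈ {G | (cnt G (FF q.1 q.2) : ℝ) < p * (FF q.1 q.2).card / 4}} := by
    rintro G ⟨S, T, hd, h8, hc⟩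
    refine ⟨(S, T), by simp [hJ, hd, h8], ?_⟩
    simp only [Set.mem_ofPred_eq]
    rw [FF_card_disj _ _ hd]
    push_cast
    rw [← mul_assoc]; exact hc
  refine ((prob_mono h0.le h1 hsub).trans (prob_biUnion h0.le h1 J _)).trans ?_
  have b2 : ∀ q ∈ J, gnpProb n p {G | (cnt G (FF q.1 q.2) : ℝ) < p * (FF q.1 q.2).card / 4} ≤
      Real.exp (-2) ^ n := by
    intro q hq
    have hq' := (Finset.mem_filter.1 hq).2
    refine (lower_tail h0 h1 _ (FF_nd _ _)).trans ?_
    rw [FF_card_disj _ _ hq'.1, ← Real.exp_nat_mul]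
    push_cast
    apply Real.exp_le_exp.2
    linarith [hq'.2]
  refine (Finset.sum_le_card_nsmul _ _ _ b2).trans ?_
  rw [nsmul_eq_mul, mul_pow]
  apply mul_le_mul_of_nonneg_right _ (by positivity)
  have : J.card ≤ 4 ^ n := by
    refine (Finset.card_filter_le _ _).trans ?_
    rw [Finset.card_univ, Fintype.card_prod, Fintype.card_finset, Fintype.card_fin, ← Nat.mul_pow]
  exact_mod_cast this

/-- degree bad events -/
lemma deg_prob {n : ℕ} {p : ℝ} (h0 : 0 < p) (h1 : p ≤ 1) (c : ℝ) (hc : 0 < c)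
    (Q : ℕ → Prop) (hQ : ∀ k, Q k → c ≤ 3 ^ k) :
    gnpProb n p {G | ∃ v, Q (cnt G (FF {v} univ))} ≤ n * ((1 + 2 * p) ^ n / c) := by
  have hsub : {G : SimpleGraph (Fin n) | ∃ v, Q (cnt G (FF {v} univ))} ⊆
      {G | ∃ v ∈ (univ : Finset (Fin n)), G ∈ {G | Q (cnt G (FF {v} univ))}} := by
    rintro G ⟨v, hv⟩
    exact ⟨v, by simp, hv⟩
  refine ((prob_mono h0.le h1 hsub).trans (prob_biUnion h0.le h1 _ _)).trans ?_
  have b2 : ∀ v ∈ (univ : Finset (Fin n)), gnpProb n p {G | Q (cnt G (FF {v} univ))} ≤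
      (1 + 2 * p) ^ n / c := by
    intro v _
    rw [le_div_iff₀ hc]
    refine (markov h0.le h1 (t := 3) (by norm_num) (FF {v} univ) (FF_nd _ _) _ (fun G hG => hQ _ hG)).trans ?_
    have : 1 + p * (3 - 1) = 1 + 2 * p := by ring
    rw [this]
    apply pow_le_pow_right₀ (by linarith)
    refine (FF_card_le _ _).trans ?_
    simp
  refine (Finset.sum_le_card_nsmul _ _ _ b2).trans ?_
  rw [nsmul_eq_mul]
  simp

/-- out-neighbourhood as a finset -/
def Nf {n : ℕ} (D : Fin n → Fin n → Prop) (u : Fin n) : Finset (Fin n) :=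
  univ.filter (fun v => D u v)

/-- first and second neighbourhoods together -/
def Xf {n : ℕ} (D : Fin n → Fin n → Prop) (u : Fin n) : Finset (Fin n) :=
  Nf D u ∪ univ.filter (fun v => v ∈ secondNbhd D u)

/-- `D` is an orientation without Seymour vertex -/
def NoSey {n : ℕ} (G : SimpleGraph (Fin n)) (D : Fin n → Fin n → Prop) : Prop :=
  IsOrientation G D ∧ ∀ u, (univ.filter (fun v => v ∈ secondNbhd D u)).card < (Nf D u).card

lemma noSey_of {n : ℕ} {G : SimpleGraph (Fin n)} {D : Fin n → Fin n → Prop}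
    (hD : IsOrientation G D) (h : ¬ HasSeymourVertex D) : NoSey G D := by
  refine ⟨hD, fun u => ?_⟩
  by_contra hu
  apply h
  refine ⟨u, ?_⟩
  unfold IsSeymourVertex
  have e1 : firstNbhd D u = (Nf D u : Set (Fin n)) := by
    ext x; simp [firstNbhd, Nf]
  have e2 : secondNbhd D u = ((univ.filter (fun v => v ∈ secondNbhd D u) : Finset (Fin n)) : Set (Fin n)) := by
    ext x; simp
  rw [e1, e2, Set.ncard_coe_finset, Set.ncard_coe_finset]
  exact not_lt.1 hu

section det

variable {n : ℕ} {G : SimpleGraph (Fin n)} {D : Fin n → Fin n → Prop}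

lemma mem_Nf {u v : Fin n} : v ∈ Nf D u ↔ D u v := by simp [Nf]

lemma asym (h : NoSey G D) {u v : Fin n} (huv : D u v) : ¬ D v u :=
  (h.1.2 u v (h.1.1 u v huv)).1 huv

lemma irr (h : NoSey G D) {u v : Fin n} (huv : D u v) : u ≠ v :=
  (h.1.1 u v huv).ne

lemma Nf_sub_Xf {u : Fin n} : Nf D u ⊆ Xf D u := Finset.subset_union_left

lemma Nf_sub_Xf' (h : NoSey G D) {u a : Fin n} (ha : a ∈ Nf D u) : Nf D a ⊆ Xf D u := by
  intro x hx
  rw [mem_Nf] at ha hx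
  unfold Xf
  rw [Finset.mem_union]
  by_cases hux : D u x
  · left; exact mem_Nf.2 hux
  · right
    simp only [Finset.mem_filter, Finset.mem_univ, true_and]
    refine ⟨hux, ?_, a, ha, hx⟩
    rintro rfl
    exact asym h ha hx

lemma Xf_card (h : NoSey G D) (u : Fin n) : (Xf D u).card ≤ 2 * (Nf D u).card := by
  unfold Xf
  have := Finset.card_union_le (Nf D u) (univ.filter (fun v => v ∈ secondNbhd D u))
  have := h.2 u
  omega

lemma arcs_le (h : NoSey G D) (A X : Finset (Fin n)) (k : ℕ)
    (hA : ∀ a ∈ A, Nf D a ⊆ X ∧ k ≤ (Nf D a).card) : A.card * k ≤ cnt G (FF A X) := by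
  have h1 : A.card * k ≤ (A.sigma (fun a => Nf D a)).card := by
    rw [Finset.card_sigma]
    have := Finset.card_nsmul_le_sum A (fun a => (Nf D a).card) k (fun a ha => (hA a ha).2)
    simpa using this
  refine h1.trans ?_
  unfold cnt
  refine Finset.card_le_card_of_injOn (fun q => s(q.1, q.2)) ?_ ?_
  · rintro ⟨a, x⟩ hq
    simp only [Finset.coe_sigma, Set.mem_sigma_iff, Finset.mem_coe] at hq
    have hax : D a x := mem_Nf.1 hq.2
    simp only [Finset.coe_filter, Set.mem_ofPred_eq, FF, Finset.mem_filter, Finset.mem_image,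
      Finset.mem_product, Prod.exists]
    refine ⟨⟨⟨a, x, ⟨hq.1, (hA a hq.1).1 hq.2⟩, rfl⟩, ?_⟩, ?_⟩
    · simpa using irr h hax
    · exact h.1.1 a x hax
  · rintro ⟨a, x⟩ hq ⟨b, y⟩ hq' heq
    simp only [Finset.coe_sigma, Set.mem_sigma_iff, Finset.mem_coe] at hq hq'
    have hax : D a x := mem_Nf.1 hq.2
    have hby : D b y := mem_Nf.1 hq'.2
    simp only [Sym2.eq_iff] at heq
    rcases heq with ⟨h1, h2⟩ | ⟨h1, h2⟩
    · subst h1; subst h2; rfl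
    · subst h1; subst h2; exact absurd hby (asym h hax)

lemma outdeg_le (h : NoSey G D) (v : Fin n) : (Nf D v).card ≤ cnt G (FF {v} univ) := by
  have := arcs_le h {v} univ (Nf D v).card (by simp)
  simpa using this

lemma Nf_card_le (v : Fin n) : (Nf D v).card ≤ n := by
  have := Finset.card_le_univ (Nf D v)
  simpa using this

lemma det1 (h : NoSey G D) (hn : 1 ≤ n) : ∃ d ∈ Finset.Icc 3 n, G ∈ UE n d (2 * d) (d * d) := by
  have : Nonempty (Fin n) := ⟨⟨0, hn⟩⟩
  obtain ⟨v, -, hv⟩ := Finset.exists_min_image (univ : Finset (Fin n)) (fun v => (Nf D v).card)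
    Finset.univ_nonempty
  have key : ∀ c ∈ Nf D v, ∃ c' ∈ Nf D v, D c c' := by
    intro c hc
    by_contra hcon
    push Not at hcon
    have hs : Nf D c ⊆ univ.filter (fun x => x ∈ secondNbhd D v) := by
      intro x hx
      have h1 := Nf_sub_Xf' h hc hx
      unfold Xf at h1
      rcases Finset.mem_union.1 h1 with h1 | h1
      · exact absurd (mem_Nf.1 hx) (hcon x h1)
      · exact h1
    have h2 := Finset.card_le_card hs
    have h3 := h.2 v
    have h4 := hv c (Finset.mem_univ _)
    omega
  have hne : (Nf D v).Nonempty := by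
    rw [← Finset.card_pos]
    have := h.2 v
    omega
  obtain ⟨a, ha⟩ := hne
  obtain ⟨b, hb, hab⟩ := key a ha
  obtain ⟨c, hc, hbc⟩ := key b hb
  have h3 : 3 ≤ (Nf D v).card := by
    have e : ({a, b, c} : Finset (Fin n)).card = 3 := by
      refine Finset.card_eq_three.2 ⟨a, b, c, irr h hab, ?_, irr h hbc, rfl⟩
      rintro rfl
      exact asym h hab hbc
    rw [← e]
    apply Finset.card_le_card
    intro x hx
    simp only [Finset.mem_insert, Finset.mem_singleton] at hx
    rcases hx with rfl | rfl | rfl <;> assumption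
  refine ⟨(Nf D v).card, Finset.mem_Icc.2 ⟨h3, Nf_card_le v⟩, Xf D v, Nf D v, Nf_sub_Xf, le_rfl, Xf_card h v, ?_⟩
  apply arcs_le h
  intro x hx
  exact ⟨Nf_sub_Xf' h hx, hv x (Finset.mem_univ _)⟩

lemma forward (h : NoSey G D) (K : ℕ) (hK : 1 ≤ K)
    (hU : ∀ d ∈ Finset.Icc 1 n, G ∉ UE n K (2 * d) (K * d)) (y : Fin n) :
    ((Nf D y).filter (fun w => (Nf D y).card ≤ (Nf D w).card)).card < K := by
  by_contra hcon
  push Not at hcon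
  obtain ⟨A, hA, hAc⟩ := Finset.exists_subset_card_eq hcon
  have hA1 : ∀ a ∈ A, a ∈ Nf D y ∧ (Nf D y).card ≤ (Nf D a).card := fun a ha => Finset.mem_filter.1 (hA ha)
  have hd : K ≤ (Nf D y).card := hcon.trans (Finset.card_filter_le _ _)
  refine hU (Nf D y).card (Finset.mem_Icc.2 ⟨hK.trans hd, Nf_card_le y⟩) ⟨Xf D y, A, ?_, hAc.le, Xf_card h y, ?_⟩
  · intro a ha
    exact Nf_sub_Xf (hA1 a ha).1
  · rw [← hAc]
    apply arcs_le h
    intro a ha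
    exact ⟨Nf_sub_Xf' h (hA1 a ha).1, (hA1 a ha).2⟩

lemma cnt_le_arcs (h : NoSey G D) (S T : Finset (Fin n)) (Q : Finset (Fin n × Fin n))
    (hQ : ∀ x ∈ S, ∀ y ∈ T, (D x y → (x, y) ∈ Q) ∧ (D y x → (y, x) ∈ Q)) :
    cnt G (FF S T) ≤ Q.card := by
  unfold cnt
  refine (Finset.card_le_card ?_).trans (Finset.card_image_le (s := Q) (f := fun q => s(q.1, q.2)))
  intro e he
  obtain ⟨he1, he2⟩ := Finset.mem_filter.1 he
  obtain ⟨⟨x, y⟩, hxy, rfl⟩ := Finset.mem_image.1 (Finset.mem_filter.1 he1).1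
  rw [Finset.mem_product] at hxy
  have hadj : G.Adj x y := he2
  rw [Finset.mem_image]
  by_cases hD : D x y
  · exact ⟨(x, y), (hQ x hxy.1 y hxy.2).1 hD, rfl⟩
  · have : D y x := by
      by_contra h'
      exact hD ((h.1.2 x y hadj).2 h')
    exact ⟨(y, x), (hQ x hxy.1 y hxy.2).2 this, Sym2.eq_swap⟩

lemma LE (h : NoSey G D) {p : ℝ} (hp : 0 < p) (hE : G ∉ LEv n p) (W : Finset (Fin n))
    (hW : 2 ≤ W.card) (hpW : 72 * n ≤ p * W.card ^ 2) :
    ∃ v ∈ W, p * W.card / 36 ≤ ((Nf D v ∩ W).card : ℝ) := by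
  obtain ⟨S, hSW, hSc⟩ := Finset.exists_subset_card_eq (show W.card / 2 ≤ W.card by omega)
  have hTc : (W \ S).card = W.card - W.card / 2 := by rw [Finset.card_sdiff_of_subset hSW, hSc]
  have hS3 : (W.card : ℝ) / 3 ≤ S.card := by
    have : W.card ≤ 3 * S.card := by omega
    have : (W.card : ℝ) ≤ 3 * S.card := by exact_mod_cast this
    linarith
  have hT3 : (W.card : ℝ) / 3 ≤ (W \ S).card := by
    have : W.card ≤ 3 * (W \ S).card := by omega
    have : (W.card : ℝ) ≤ 3 * (W \ S).card := by exact_mod_cast this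
    linarith
  have hprod : p * W.card ^ 2 / 9 ≤ p * S.card * (W \ S).card := by
    have : (W.card : ℝ) / 3 * (W.card / 3) ≤ S.card * (W \ S).card :=
      mul_le_mul hS3 hT3 (by positivity) (by positivity)
    nlinarith
  have hcnt : p * W.card ^ 2 / 36 ≤ (cnt G (FF S (W \ S)) : ℝ) := by
    by_contra hcon
    push Not at hcon
    exact hE ⟨S, W \ S, Finset.disjoint_sdiff, by linarith, by linarith⟩
  have hle := cnt_le_arcs h S (W \ S) ((W ×ˢ W).filter (fun q => D q.1 q.2)) (by
    intro x hx y hy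
    have hx' := hSW hx
    have hy' := (Finset.mem_sdiff.1 hy).1
    simp [hx', hy'])
  have hsum : ((W ×ˢ W).filter (fun q => D q.1 q.2)).card = ∑ v ∈ W, (Nf D v ∩ W).card := by
    rw [← Finset.card_sigma]
    refine Finset.card_bij' (fun q _ => ⟨q.1, q.2⟩) (fun q _ => (q.1, q.2)) ?_ ?_ ?_ ?_
    · intro q hq; simp at hq; simp [hq, mem_Nf]
    · intro q hq; simp [mem_Nf] at hq; simp [hq]
    · intros; rfl
    · intros; rfl
  by_contra hcon
  push Not at hcon
  have hlt : (∑ v ∈ W, ((Nf D v ∩ W).card : ℝ)) < ∑ v ∈ W, p * W.card / 36 := by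
    apply Finset.sum_lt_sum_of_nonempty
    · rw [← Finset.card_pos]; omega
    · exact hcon
  rw [Finset.sum_const, nsmul_eq_mul] at hlt
  have hle' : (cnt G (FF S (W \ S)) : ℝ) ≤ ∑ v ∈ W, ((Nf D v ∩ W).card : ℝ) := by
    rw [hsum] at hle
    exact_mod_cast hle
  nlinarith

lemma det2 (h : NoSey G D) {p : ℝ} (hp : 0 < p) (hE : G ∉ LEv n p)
    (hdeg : ∀ v, ¬ (8 * p * n ≤ (cnt G (FF {v} univ) : ℝ))) (hpn : 700000 ≤ p * n) (hn : 4 ≤ n) :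
    ∃ d ∈ Finset.Icc 1 n, G ∈ UE n 9216 (2 * d) (16 * d) := by
  set H := univ.filter (fun v => p * n / 72 ≤ ((Nf D v).card : ℝ)) with hH
  have hnpos : (0 : ℝ) < n := by positivity
  have big : ∀ W : Finset (Fin n), n ≤ 2 * W.card →
      ∃ v ∈ W, p * n / 72 ≤ ((Nf D v ∩ W).card : ℝ) := by
    intro W hW
    have hW' : (n : ℝ) / 2 ≤ W.card := by
      have : (n : ℝ) ≤ 2 * W.card := by exact_mod_cast hW
      linarith
    obtain ⟨v, hv, hv2⟩ := LE h hp hE W (by omega) (by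
      have : (n / 2 : ℝ) ^ 2 ≤ (W.card : ℝ) ^ 2 := pow_le_pow_left₀ (by positivity) hW' 2
      nlinarith)
    refine ⟨v, hv, le_trans ?_ hv2⟩
    nlinarith
  have hHc : n ≤ 2 * H.card := by
    by_contra hcon
    have hc : H.card + Hᶜ.card = n := by
      rw [Finset.card_add_card_compl]; simp
    obtain ⟨v, hv, hv2⟩ := big Hᶜ (by omega)
    rw [Finset.mem_compl] at hv
    apply hv
    rw [hH, Finset.mem_filter]
    refine ⟨Finset.mem_univ _, hv2.trans ?_⟩
    exact_mod_cast Finset.card_le_card Finset.inter_subset_left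
  obtain ⟨v, hv, hv2⟩ := big H hHc
  have hbig : 9216 ≤ (Nf D v ∩ H).card := by
    have : (9216 : ℝ) ≤ (Nf D v ∩ H).card := by linarith
    exact_mod_cast this
  obtain ⟨A, hA, hAc⟩ := Finset.exists_subset_card_eq hbig
  have hA1 : ∀ a ∈ A, a ∈ Nf D v ∧ p * n / 72 ≤ ((Nf D a).card : ℝ) := by
    intro a ha
    have := Finset.mem_inter.1 (hA ha)
    exact ⟨this.1, (Finset.mem_filter.1 this.2).2⟩
  have hd1 : 9216 ≤ (Nf D v).card := hbig.trans (Finset.card_le_card Finset.inter_subset_left)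
  have hd8 : ((Nf D v).card : ℝ) < 8 * p * n := by
    have h1 := hdeg v
    push Not at h1
    refine lt_of_le_of_lt ?_ h1
    exact_mod_cast outdeg_le h v
  refine ⟨(Nf D v).card, Finset.mem_Icc.2 ⟨by omega, Nf_card_le v⟩, Xf D v, A, ?_, hAc.le, Xf_card h v, ?_⟩
  · intro a ha
    exact Nf_sub_Xf (hA1 a ha).1
  · have h1 := arcs_le h A (Xf D v) (((Nf D v).card + 575) / 576) (by
      intro a ha
      refine ⟨Nf_sub_Xf' h (hA1 a ha).1, ?_⟩
      have h2 := (hA1 a ha).2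
      have h3 : (Nf D v).card ≤ 576 * (Nf D a).card := by
        have : ((Nf D v).card : ℝ) ≤ 576 * (Nf D a).card := by linarith
        exact_mod_cast this
      omega)
    rw [hAc] at h1
    omega

lemma exists_top (f : Fin n → ℕ) (m : ℕ) (hm : m ≤ n) :
    ∃ W : Finset (Fin n), W.card = m ∧ ∀ w ∈ W, ∀ y, y ∉ W → f y ≤ f w := by
  induction m with
  | zero => exact ⟨∅, by simp, by simp⟩
  | succ m ih =>
    obtain ⟨W, hWc, hW⟩ := ih (by omega)
    have hne : (Wᶜ).Nonempty := by
      rw [← Finset.card_pos, Finset.card_compl, Fintype.card_fin]; omega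
    obtain ⟨x, hx, hmax⟩ := Finset.exists_max_image Wᶜ f hne
    rw [Finset.mem_compl] at hx
    refine ⟨insert x W, by rw [Finset.card_insert_of_notMem hx, hWc], ?_⟩
    intro w hw y hy
    rw [Finset.mem_insert, not_or] at hy
    rcases Finset.mem_insert.1 hw with rfl | hw
    · exact hmax y (Finset.mem_compl.2 hy.2)
    · exact hW w hw y hy.2

lemma det3 (h : NoSey G D) {p : ℝ} (hp : 0 < p) (hE : G ∉ LEv n p)
    (hdeg : ∀ v, ¬ (9 * n ≤ 20 * cnt G (FF {v} univ))) (hpn : 120000 ≤ p * n)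
    (hp2n : 300000 ≤ p ^ 2 * n) (hn : 40 ≤ n) (K : ℕ) (hK : 1 ≤ K)
    (hU : ∀ d ∈ Finset.Icc 1 n, G ∉ UE n K (2 * d) (K * d)) (hKp : 5760 * K < p ^ 2 * n) : False := by
  have hnpos : (0 : ℝ) < n := by positivity
  obtain ⟨W, hWc, hW⟩ := exists_top (fun v => (Nf D v).card) (n / 20) (by omega)
  have hW' : (n : ℝ) / 40 ≤ W.card := by
    have : n ≤ 40 * W.card := by omega
    have : (n : ℝ) ≤ 40 * W.card := by exact_mod_cast this
    linarith
  obtain ⟨v, hv, hv2⟩ := LE h hp hE W (by omega) (by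
    have : (n / 40 : ℝ) ^ 2 ≤ (W.card : ℝ) ^ 2 := pow_le_pow_left₀ (by positivity) hW' 2
    nlinarith)
  set A := Nf D v ∩ W with hA
  set Y := Wᶜ \ Xf D v with hY
  have hAc : p * n / 1440 ≤ A.card := by
    refine le_trans ?_ hv2
    nlinarith
  have hYc : n ≤ 20 * Y.card := by
    have h1 : Wᶜ.card - (Xf D v).card ≤ Y.card := Finset.le_card_sdiff (Xf D v) Wᶜ
    have h2 := Xf_card h v
    have h3 := hdeg v
    have h4 := outdeg_le h v
    rw [Finset.card_compl, Fintype.card_fin] at h1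
    omega
  have hYc' : (n : ℝ) / 20 ≤ Y.card := by
    have : (n : ℝ) ≤ 20 * Y.card := by exact_mod_cast hYc
    linarith
  have hdisj : Disjoint A Y := by
    rw [Finset.disjoint_left]
    intro x hx hx'
    exact (Finset.mem_sdiff.1 hx').2 (Nf_sub_Xf (Finset.mem_inter.1 hx).1)
  have hprod : p * n / 1440 * (n / 20) ≤ A.card * Y.card :=
    mul_le_mul hAc hYc' (by positivity) (by positivity)
  have h8 : 8 * n ≤ p * A.card * Y.card := by
    have h1 : p * (p * n / 1440 * (n / 20)) ≤ p * (A.card * Y.card) :=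
      mul_le_mul_of_nonneg_left hprod hp.le
    have h2 : (300000 : ℝ) * n ≤ p ^ 2 * n * n := mul_le_mul_of_nonneg_right hp2n hnpos.le
    nlinarith
  have hcnt : p * A.card * Y.card / 4 ≤ (cnt G (FF A Y) : ℝ) := by
    by_contra hcon
    push Not at hcon
    exact hE ⟨A, Y, hdisj, h8, hcon⟩
  have hle := cnt_le_arcs h A Y ((Y.sigma (fun y => (Nf D y).filter
      (fun w => (Nf D y).card ≤ (Nf D w).card))).image (fun q => (q.1, q.2))) (by
    intro x hx y hy
    obtain ⟨hx1, hx2⟩ := Finset.mem_inter.1 hx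
    obtain ⟨hy1, hy2⟩ := Finset.mem_sdiff.1 hy
    rw [Finset.mem_compl] at hy1
    refine ⟨fun hxy => absurd (Nf_sub_Xf' h hx1 (mem_Nf.2 hxy)) hy2, fun hyx => ?_⟩
    rw [Finset.mem_image]
    refine ⟨⟨y, x⟩, ?_, rfl⟩
    rw [Finset.mem_sigma, Finset.mem_filter]
    exact ⟨hy, mem_Nf.2 hyx, hW x hx2 y hy1⟩)
  have hle2 : cnt G (FF A Y) ≤ Y.card * K := by
    refine hle.trans (Finset.card_image_le.trans ?_)
    rw [Finset.card_sigma]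
    have := Finset.sum_le_card_nsmul Y (fun y => ((Nf D y).filter
      (fun w => (Nf D y).card ≤ (Nf D w).card)).card) K (fun y _ => (forward h K hK hU y).le)
    simpa using this
  have hle3 : (cnt G (FF A Y) : ℝ) ≤ Y.card * K := by exact_mod_cast hle2
  have hYpos : (0 : ℝ) < Y.card := lt_of_lt_of_le (by positivity) hYc'
  have hfin : p * A.card / 4 ≤ K := by
    by_contra hcon
    push Not at hcon
    have := mul_lt_mul_of_pos_right hcon hYpos
    nlinarith
  have : p * (p * n / 1440) ≤ p * A.card := mul_le_mul_of_nonneg_left hAc hp.le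
  nlinarith

end det

/-- graphs having an orientation without Seymour vertex -/
def Bad (n : ℕ) : Set (SimpleGraph (Fin n)) := {G | ∃ D, NoSey G D}

/-- a large constant -/
def CC : ℝ := 16 * (2 ^ 9216) ^ 2

lemma CC_pos : 0 < CC := by unfold CC; positivity

lemma case1 {n : ℕ} (hn : 1 ≤ n) {p s : ℝ} (h0 : 0 < p) (h4 : 4 * p ≤ 1) (hs : 0 < s)
    (hsn : s ^ 8 = n) (hps : p * s ^ 7 ≤ 1) (hs5 : 1024 ≤ s ^ 5) :
    gnpProb n p (Bad n) ≤ 1024 ^ 3 / s ^ 7 := by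
  have h1 : p ≤ 1 := by linarith
  have hsub : Bad n ⊆ {G | ∃ d ∈ Finset.Icc 3 n, G ∈ UE n d (2 * d) (d * d)} := by
    rintro G ⟨D, hD⟩
    exact det1 hD hn
  refine ((prob_mono h0.le h1 hsub).trans (prob_biUnion h0.le h1 _ _)).trans ?_
  have hx : 16 * (n : ℝ) ^ 2 * (4 * p) ^ 3 ≤ 1024 / s ^ 5 := by
    have h7 : p ^ 3 * s ^ 21 ≤ 1 := by
      have := pow_le_pow_left₀ (by positivity) hps 3
      calc p ^ 3 * s ^ 21 = (p * s ^ 7) ^ 3 := by ring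
        _ ≤ 1 := by simpa using this
    rw [le_div_iff₀ (by positivity), ← hsn]
    nlinarith
  have hx1 : 1024 / s ^ 5 ≤ 1 := by
    rw [div_le_one (by positivity)]; exact hs5
  have b : ∀ d ∈ Finset.Icc 3 n, gnpProb n p (UE n d (2 * d) (d * d)) ≤ (1024 / s ^ 5) ^ 3 := by
    intro d hd
    have hd3 := (Finset.mem_Icc.1 hd).1
    refine (UE_prob hn h0 h1 _ _ _).trans ?_
    have e : (4 * (n : ℝ)) ^ (2 * d) * 2 ^ (d * (2 * d)) * p ^ (d * d) = (16 * (n : ℝ) ^ 2 * (4 * p) ^ d) ^ d := by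
      rw [mul_pow (16 * (n : ℝ) ^ 2), ← pow_mul, mul_pow 4 p, pow_mul (4 * (n : ℝ)),
        show d * (2 * d) = 2 * (d * d) by ring, pow_mul (2 : ℝ) 2]
      norm_num
      ring
    rw [e]
    have e2 : 16 * (n : ℝ) ^ 2 * (4 * p) ^ d ≤ 1024 / s ^ 5 := by
      refine le_trans ?_ hx
      apply mul_le_mul_of_nonneg_left _ (by positivity)
      exact pow_le_pow_of_le_one (by positivity) h4 hd3
    calc _ ≤ (1024 / s ^ 5) ^ d := pow_le_pow_left₀ (by positivity) e2 d
      _ ≤ _ := pow_le_pow_of_le_one (by positivity) hx1 hd3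
  refine (Finset.sum_le_card_nsmul _ _ _ b).trans ?_
  rw [nsmul_eq_mul, Nat.card_Icc]
  have hc : ((n + 1 - 3 : ℕ) : ℝ) ≤ s ^ 8 := by
    rw [hsn]
    exact_mod_cast (by omega : n + 1 - 3 ≤ n)
  calc _ ≤ s ^ 8 * (1024 / s ^ 5) ^ 3 := mul_le_mul_of_nonneg_right hc (by positivity)
    _ = _ := by field_simp

lemma sum_UE {n : ℕ} (hn : 1 ≤ n) {p : ℝ} (h0 : 0 < p) (h1 : p ≤ 1) (a j : ℕ) (x : ℝ)
    (hx : 16 * (n : ℝ) ^ 2 * ((2 ^ a) ^ 2 * p ^ j) ≤ x) (hx1 : x ≤ 1) :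
    gnpProb n p {G | ∃ d ∈ Finset.Icc 1 n, G ∈ UE n a (2 * d) (j * d)} ≤ n * x := by
  refine (prob_biUnion h0.le h1 _ _).trans ?_
  have hx0 : 0 ≤ x := le_trans (by positivity) hx
  have b : ∀ d ∈ Finset.Icc 1 n, gnpProb n p (UE n a (2 * d) (j * d)) ≤ x := by
    intro d hd
    have hd3 := (Finset.mem_Icc.1 hd).1
    refine (UE_prob hn h0 h1 _ _ _).trans ?_
    have e : (4 * (n : ℝ)) ^ (2 * d) * 2 ^ (a * (2 * d)) * p ^ (j * d) =
        (16 * (n : ℝ) ^ 2 * ((2 ^ a) ^ 2 * p ^ j)) ^ d := by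
      rw [pow_mul (4 * (n : ℝ)), ← mul_assoc a, pow_mul (2 : ℝ) (a * 2), pow_mul (2 : ℝ) a, pow_mul p,
        ← mul_pow, ← mul_pow]
      congr 1
      ring
    rw [e]
    calc _ ≤ x ^ d := pow_le_pow_left₀ (by positivity) hx d
      _ ≤ x ^ 1 := pow_le_pow_of_le_one hx0 hx1 hd3
      _ = x := pow_one x
  refine (Finset.sum_le_card_nsmul _ _ _ b).trans ?_
  rw [nsmul_eq_mul, Nat.card_Icc]
  simp

lemma case2 {n : ℕ} (hn : 4 ≤ n) {p s : ℝ} (h0 : 0 < p) (h1 : p ≤ 1) (hs : 700000 ≤ s)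
    (hsn : s ^ 8 = n) (hps : 1 ≤ p * s ^ 7) (hps2 : p * s ^ 2 ≤ 1) (hC : CC ≤ s ^ 16) :
    gnpProb n p (Bad n) ≤ (4 * Real.exp (-2)) ^ n + (s ^ 8 * Real.exp (-s) + CC / s ^ 8) := by
  have hs0 : 0 < s := by linarith
  have hpn : s ≤ p * n := by
    rw [← hsn]; nlinarith
  set Q : ℕ → Prop := fun k => 8 * p * n ≤ (k : ℝ) with hQ
  set U : Set (SimpleGraph (Fin n)) := {G | ∃ d ∈ Finset.Icc 1 n, G ∈ UE n 9216 (2 * d) (16 * d)} with hU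
  have hsub : Bad n ⊆ LEv n p ∪ ({G | ∃ v, Q (cnt G (FF {v} univ))} ∪ U) := by
    rintro G ⟨D, hD⟩
    by_cases c1 : G ∈ LEv n p
    · exact Or.inl c1
    by_cases c2 : ∃ v, Q (cnt G (FF {v} univ))
    · exact Or.inr (Or.inl c2)
    · push Not at c2
      exact Or.inr (Or.inr (det2 hD h0 c1 c2 (hs.trans hpn) hn))
  refine (prob_mono h0.le h1 hsub).trans ((prob_union h0.le h1 _ _).trans
    (add_le_add (LEv_prob h0 h1) ((prob_union h0.le h1 _ _).trans (add_le_add ?_ ?_))))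
  · refine (deg_prob h0 h1 (Real.exp (8 * p * n)) (Real.exp_pos _) Q ?_).trans ?_
    · intro k hk
      calc Real.exp (8 * p * n) ≤ Real.exp k := Real.exp_le_exp.2 hk
        _ = Real.exp 1 ^ k := by rw [← Real.exp_nat_mul]; simp
        _ ≤ 3 ^ k := pow_le_pow_left₀ (Real.exp_pos _).le Real.exp_one_lt_three.le k
    · rw [← hsn]
      apply mul_le_mul_of_nonneg_left _ (by positivity)
      rw [hsn, div_le_iff₀ (Real.exp_pos _), ← Real.exp_add]
      calc (1 + 2 * p) ^ n ≤ Real.exp (2 * p) ^ n := by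
            apply pow_le_pow_left₀ (by positivity)
            linarith [Real.add_one_le_exp (2 * p)]
        _ = Real.exp (n * (2 * p)) := by rw [← Real.exp_nat_mul]
        _ ≤ _ := Real.exp_le_exp.2 (by nlinarith)
  · have hp16 : p ^ 16 * s ^ 32 ≤ 1 := by
      have := pow_le_pow_left₀ (by positivity) hps2 16
      calc p ^ 16 * s ^ 32 = (p * s ^ 2) ^ 16 := by ring
        _ ≤ 1 := by simpa using this
    have h := sum_UE (n := n) (by omega) h0 h1 9216 16 (CC / s ^ 16) (by
      rw [le_div_iff₀ (by positivity), ← hsn]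
      have : 16 * (s ^ 8) ^ 2 * ((2 ^ 9216) ^ 2 * p ^ 16) * s ^ 16 = CC * (p ^ 16 * s ^ 32) := by
        unfold CC
        generalize (2 : ℝ) ^ 9216 = c
        ring
      rw [this]
      have := CC_pos
      nlinarith) (by rw [div_le_one (by positivity)]; exact hC)
    refine h.trans (le_of_eq ?_)
    rw [← hsn]
    field_simp

lemma case3 {n : ℕ} (hn : 40 ≤ n) {p q s : ℝ} (h0 : 0 < p) (hpq : p ≤ q) (hq : q < 1 / 4) (hs : 1000 ≤ s)
    (hsn : s ^ 8 = n) (hps : 1 ≤ p * s ^ 2)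
    (hx : 16 * s ^ 16 * (4 * q) ^ ⌈s⌉₊ ≤ 1) :
    gnpProb n p (Bad n) ≤ (4 * Real.exp (-2)) ^ n + (n * (15 / 16) ^ n +
      16 * s ^ 24 * (4 * q) ^ ⌈s⌉₊) := by
  have h1 : p ≤ 1 := by linarith
  have hs0 : 0 < s := by linarith
  have hpn : s ^ 6 ≤ p * n := by
    rw [← hsn]
    calc s ^ 6 = 1 * s ^ 6 := by ring
      _ ≤ (p * s ^ 2) * s ^ 6 := mul_le_mul_of_nonneg_right hps (by positivity)
      _ = _ := by ring
  have hp2n : s ^ 4 ≤ p ^ 2 * n := by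
    rw [← hsn]
    calc s ^ 4 = 1 ^ 2 * s ^ 4 := by ring
      _ ≤ (p * s ^ 2) ^ 2 * s ^ 4 :=
        mul_le_mul_of_nonneg_right (pow_le_pow_left₀ (by norm_num) hps 2) (by positivity)
      _ = _ := by ring
  have hs6 : (1000 : ℝ) ^ 6 ≤ s ^ 6 := pow_le_pow_left₀ (by norm_num) hs 6
  have hs4 : (1000 : ℝ) ^ 4 ≤ s ^ 4 := pow_le_pow_left₀ (by norm_num) hs 4
  have hs3 : (1000 : ℝ) ^ 3 ≤ s ^ 3 := pow_le_pow_left₀ (by norm_num) hs 3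
  set K := ⌈s⌉₊ with hK
  have hK1 : 1 ≤ K := Nat.one_le_ceil_iff.2 hs0
  have hKs : (K : ℝ) < s + 1 := Nat.ceil_lt_add_one hs0.le
  set Q : ℕ → Prop := fun k => 9 * n ≤ 20 * k with hQ
  set U : Set (SimpleGraph (Fin n)) := {G | ∃ d ∈ Finset.Icc 1 n, G ∈ UE n K (2 * d) (K * d)} with hU
  have hsub : Bad n ⊆ LEv n p ∪ ({G | ∃ v, Q (cnt G (FF {v} univ))} ∪ U) := by
    rintro G ⟨D, hD⟩
    by_cases c1 : G ∈ LEv n p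
    · exact Or.inl c1
    by_cases c2 : ∃ v, Q (cnt G (FF {v} univ))
    · exact Or.inr (Or.inl c2)
    by_cases c3 : G ∈ U
    · exact Or.inr (Or.inr c3)
    · exfalso
      push Not at c2
      refine det3 hD h0 c1 (fun v hv => absurd hv (not_le.2 (by simpa [hQ] using c2 v))) (by linarith) (by linarith) hn K hK1 ?_ ?_
      · intro d hd hG
        exact c3 ⟨d, hd, hG⟩
      · have : s ^ 4 = s ^ 3 * s := by ring
        nlinarith
  refine (prob_mono h0.le h1 hsub).trans ((prob_union h0.le h1 _ _).trans
    (add_le_add (LEv_prob h0 h1) ((prob_union h0.le h1 _ _).trans (add_le_add ?_ ?_))))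
  · refine (deg_prob h0 h1 ((8 / 5) ^ n) (by positivity) Q ?_).trans ?_
    · intro k hk
      have hk' : 9 * n ≤ 20 * k := hk
      refine le_of_pow_le_pow_left₀ (n := 20) (by norm_num) (by positivity) ?_
      calc (((8 : ℝ) / 5) ^ n) ^ 20 = ((8 / 5) ^ 20) ^ n := by rw [← pow_mul, ← pow_mul, mul_comm]
        _ ≤ (3 ^ 9) ^ n := pow_le_pow_left₀ (by positivity) (by norm_num) n
        _ = 3 ^ (9 * n) := by rw [← pow_mul]
        _ ≤ 3 ^ (20 * k) := pow_le_pow_right₀ (by norm_num) hk'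
        _ = _ := by rw [← pow_mul, mul_comm]
    · apply mul_le_mul_of_nonneg_left _ (by positivity)
      rw [← div_pow]
      apply pow_le_pow_left₀ (by positivity)
      linarith
  · have hp4 : (2 ^ K) ^ 2 * p ^ K ≤ (4 * q) ^ K := by
      rw [← pow_mul, mul_comm K 2, pow_mul, ← mul_pow]
      apply pow_le_pow_left₀ (by positivity)
      linarith
    have h := sum_UE (n := n) (by omega) h0 h1 K K (16 * s ^ 16 * (4 * q) ^ K) (by
      rw [← hsn, ← pow_mul]
      exact mul_le_mul_of_nonneg_left hp4 (by positivity)) hx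
    refine h.trans (le_of_eq ?_)
    rw [← hsn]
    ring

lemma bad_compl (n : ℕ) :
    {G : SimpleGraph (Fin n) | ∀ D : Fin n → Fin n → Prop, IsOrientation G D → HasSeymourVertex D}ᶜ ⊆ Bad n := by
  intro G hG
  rw [Set.mem_compl_iff] at hG
  have : ¬ ∀ D : Fin n → Fin n → Prop, IsOrientation G D → HasSeymourVertex D := hG
  push Not at this
  obtain ⟨D, h1, h2⟩ := this
  exact ⟨D, noSey_of h1 h2⟩

open Filter Topology

/-- eighth root -/
def rt (n : ℕ) : ℝ := (n : ℝ) ^ (1 / 8 : ℝ)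

lemma rt_pow (n : ℕ) : rt n ^ 8 = n := by
  unfold rt
  rw [← Real.rpow_natCast, ← Real.rpow_mul (by positivity)]
  norm_num

lemma rt_tendsto : Tendsto rt atTop atTop :=
  (tendsto_rpow_atTop (by norm_num)).comp tendsto_natCast_atTop_atTop

lemma geo {r : ℝ} (hr0 : 0 < r) (hr1 : r < 1) (k : ℕ) :
    Tendsto (fun n : ℕ => 16 * rt n ^ k * r ^ ⌈rt n⌉₊) atTop (𝓝 0) := by
  have h1 : Tendsto (fun x : ℝ => 16 * (x ^ (k : ℝ) * Real.exp (-(-Real.log r) * x))) atTop (𝓝 0) := by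
    have := (tendsto_rpow_mul_exp_neg_mul_atTop_nhds_zero (k : ℝ) (-Real.log r)
      (by linarith [Real.log_neg hr0 hr1])).const_mul 16
    simpa using this
  refine squeeze_zero' ?_ ?_ (h1.comp rt_tendsto)
  · filter_upwards [rt_tendsto.eventually_ge_atTop 0] with n hn
    positivity
  · filter_upwards [rt_tendsto.eventually_ge_atTop 0] with n hn
    simp only [Function.comp]
    rw [mul_assoc, Real.rpow_natCast]
    have : r ^ ⌈rt n⌉₊ ≤ Real.exp (- -Real.log r * rt n) := by
      rw [neg_neg, ← Real.rpow_def_of_pos hr0, ← Real.rpow_natCast]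
      exact Real.rpow_le_rpow_of_exponent_ge hr0 hr1.le (Nat.le_ceil _)
    gcongr

lemma four_exp : 4 * Real.exp (-2) < 1 := by
  have h := Real.exp_one_gt_d9
  have : Real.exp 2 = Real.exp 1 * Real.exp 1 := by rw [← Real.exp_add]; norm_num
  rw [Real.exp_neg, ← div_eq_mul_inv, div_lt_one (Real.exp_pos _), this]
  nlinarith

lemma div_pow_tendsto (c : ℝ) (k : ℕ) (hk : k ≠ 0) :
    Tendsto (fun n : ℕ => c / rt n ^ k) atTop (𝓝 0) :=
  ((tendsto_pow_atTop hk).comp rt_tendsto).const_div_atTop c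

/-- total error -/
def err (q : ℝ) (n : ℕ) : ℝ :=
  1024 ^ 3 / rt n ^ 7 + ((4 * Real.exp (-2)) ^ n + (rt n ^ 8 * Real.exp (-rt n) + CC / rt n ^ 8)) +
    ((4 * Real.exp (-2)) ^ n + (n * (15 / 16) ^ n + 16 * rt n ^ 24 * (4 * q) ^ ⌈rt n⌉₊))

lemma err_tendsto {q : ℝ} (hq0 : 0 < q) (hq : q < 1 / 4) : Tendsto (err q) atTop (𝓝 0) := by
  have t1 := div_pow_tendsto (1024 ^ 3) 7 (by norm_num)
  have t2 : Tendsto (fun n : ℕ => (4 * Real.exp (-2)) ^ n) atTop (𝓝 0) :=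
    tendsto_pow_atTop_nhds_zero_of_lt_one (by positivity) four_exp
  have t3 : Tendsto (fun n : ℕ => rt n ^ 8 * Real.exp (-rt n)) atTop (𝓝 0) :=
    (Real.tendsto_pow_mul_exp_neg_atTop_nhds_zero 8).comp rt_tendsto
  have t4 := div_pow_tendsto CC 8 (by norm_num)
  have t5 : Tendsto (fun n : ℕ => (n : ℝ) * (15 / 16) ^ n) atTop (𝓝 0) :=
    tendsto_self_mul_const_pow_of_lt_one (by norm_num) (by norm_num)
  have t6 := geo (r := 4 * q) (by linarith) (by linarith) 24
  have := (t1.add (t2.add (t3.add t4))).add (t2.add (t5.add t6))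
  simp only [add_zero] at this
  exact this

lemma bad_le {q : ℝ} (hq0 : 0 < q) (hq : q < 1 / 4) :
    ∀ᶠ n : ℕ in atTop, ∀ p : ℝ, 0 < p → p ≤ q → gnpProb n p (Bad n) ≤ err q n := by
  have t6 := geo (r := 4 * q) (by linarith) (by linarith) 16
  have e6 := t6.eventually (ge_mem_nhds (show (0 : ℝ) < 1 by norm_num))
  have e16 := ((tendsto_pow_atTop (α := ℝ) (n := 16) (by norm_num)).comp rt_tendsto).eventually_ge_atTop CC
  filter_upwards [e6, e16, rt_tendsto.eventually_ge_atTop 700000, eventually_ge_atTop 40] with n h6 h16 hs hn p hp hpq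
  have hs0 : 0 < rt n := by linarith
  have hC := CC_pos
  have n1 : 0 ≤ 1024 ^ 3 / rt n ^ 7 := by positivity
  have n2 : 0 ≤ (4 * Real.exp (-2)) ^ n + (rt n ^ 8 * Real.exp (-rt n) + CC / rt n ^ 8) := by positivity
  have n3 : 0 ≤ (4 * Real.exp (-2)) ^ n + (n * (15 / 16) ^ n + 16 * rt n ^ 24 * (4 * q) ^ ⌈rt n⌉₊) := by positivity
  unfold err
  rcases le_total (p * rt n ^ 7) 1 with c1 | c1
  · have h5 : (1024 : ℝ) ≤ rt n ^ 5 := by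
      calc (1024 : ℝ) ≤ 700000 ^ 5 := by norm_num
        _ ≤ _ := pow_le_pow_left₀ (by norm_num) hs 5
    have := case1 (n := n) (by omega) hp (by linarith) hs0 (rt_pow n) c1 h5
    linarith
  rcases le_total (p * rt n ^ 2) 1 with c2 | c2
  · have := case2 (n := n) (by omega) hp (by linarith) hs (rt_pow n) c1 c2 h16
    linarith
  · have := case3 (n := n) hn hp hpq hq (by linarith) (rt_pow n) c2 h6
    linarith

lemma main (p : ℕ → ℝ) (hp : ∀ n, p n ∈ Set.Ioo (0 : ℝ) 1)
    (hlimsup : Filter.limsup p Filter.atTop < 1 / 4) :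
    Filter.Tendsto
      (fun n => gnpProb n (p n)
        {G | ∀ D : Fin n → Fin n → Prop, IsOrientation G D → HasSeymourVertex D})
      Filter.atTop (nhds 1) := by
  obtain ⟨q, hq1, hq2⟩ := exists_between hlimsup
  have hbdd : IsBoundedUnder (· ≤ ·) atTop p := isBoundedUnder_of ⟨1, fun n => (hp n).2.le⟩
  have hev := Filter.eventually_lt_of_limsup_lt hq1 hbdd
  have hq0 : 0 < q := by
    obtain ⟨n, hn⟩ := hev.exists
    exact (hp n).1.trans hn
  have hlow : Tendsto (fun n => 1 - err q n) atTop (𝓝 1) := by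
    simpa using (err_tendsto hq0 hq2).const_sub 1
  refine tendsto_of_tendsto_of_tendsto_of_le_of_le' hlow tendsto_const_nhds ?_ ?_
  · filter_upwards [hev, bad_le hq0 hq2] with n h1 h2
    have h3 := h2 (p n) (hp n).1 h1.le
    have h4 := prob_mono (n := n) (hp n).1.le (hp n).2.le (bad_compl n)
    have h5 := prob_compl (n := n) (p := p n)
      {G | ∀ D : Fin n → Fin n → Prop, IsOrientation G D → HasSeymourVertex D}
    linarith
  · refine Eventually.of_forall fun n => ?_
    have h5 := prob_compl (n := n) (p := p n)
      {G | ∀ D : Fin n → Fin n → Prop, IsOrientation G D → HasSeymourVertex D}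
    have h6 := prob_nonneg (n := n) (hp n).1.le (hp n).2.le
      {G | ∀ D : Fin n → Fin n → Prop, IsOrientation G D → HasSeymourVertex D}ᶜ
    linarith

end

end SNC

/-- If `limsup p < 1/4`, then a.a.s. every orientation of `G(n, p(n))`
contains a Seymour vertex. -/
theorem snc_gnp_all_orientations (p : ℕ → ℝ) (hp : ∀ n, p n ∈ Set.Ioo (0 : ℝ) 1)
    (hlimsup : Filter.limsup p Filter.atTop < 1 / 4) :
    Filter.Tendsto
      (fun n => gnpProb n (p n)
        {G | ∀ D : Fin n → Fin n → Prop, IsOrientation G D → HasSeymourVertex D})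
      Filter.atTop (nhds 1) := by
  exact SNC.main p hp hlimsup
end

section
/- For every β > 0 there exists a constant C = C(β) such that the following holds for every function p : ℕ → (0,1) with limsup_{n→∞} p(n) ≤ 2/3 − β: asymptotically almost surely, every orientation of G(n, p(n)) whose minimum outdegree is at least C·n^{1/2} contains a Seymour vertex. -/
/-- The weight of a graph in the binomial model. -/
noncomputable def gnpW (n : ℕ) (p : ℝ) (G : SimpleGraph (Fin n)) : ℝ :=
  p ^ G.edgeSet.ncard * (1 - p) ^ (n.choose 2 - G.edgeSet.ncard)

lemma gnpW_nonneg {n : ℕ} {p : ℝ} (h : p ∈ Set.Ioo (0 : ℝ) 1) (G : SimpleGraph (Fin n)) :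
    0 ≤ gnpW n p G := by
  have h1 := h.1.le
  have h2 : 0 ≤ 1 - p := by linarith [h.2]
  unfold gnpW
  positivity

open scoped Classical in
/-- Exponential moment of the number of edges in a set of potential edges. -/
lemma gnp_moment (n : ℕ) (p a : ℝ) (S : Finset (Sym2 (Fin n)))
    (hS : S ⊆ (⊤ : SimpleGraph (Fin n)).edgeFinset) :
    ∑ G : SimpleGraph (Fin n), gnpW n p G * a ^ (G.edgeFinset ∩ S).card
      = (1 - p + p * a) ^ S.card := by
  set U := (⊤ : SimpleGraph (Fin n)).edgeFinset with hU
  have hUc : U.card = n.choose 2 := by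
    rw [hU, SimpleGraph.card_edgeFinset_top_eq_card_choose_two, Fintype.card_fin]
  have h := Finset.prod_add (fun e => p * (if e ∈ S then a else 1)) (fun _ => 1 - p) U
  have hl : ∏ e ∈ U, (p * (if e ∈ S then a else 1) + (1 - p)) = (1 - p + p * a) ^ S.card := by
    rw [← Finset.prod_subset hS]
    · rw [Finset.prod_congr rfl (g := fun _ => 1 - p + p * a), Finset.prod_const]
      intro e he
      simp only [he, if_true]
      ring
    · intro e _ he
      simp [he]
  rw [← hl, h]
  refine Finset.sum_bij' (fun G _ => G.edgeFinset) (fun t _ => SimpleGraph.fromEdgeSet (t : Set _))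
    ?_ ?_ ?_ ?_ ?_
  · intro G _
    rw [Finset.mem_powerset]
    exact SimpleGraph.edgeFinset_mono le_top
  · intro t _
    simp
  · intro G _
    simp
  · intro t ht
    rw [Finset.mem_powerset] at ht
    ext e
    simp only [SimpleGraph.mem_edgeFinset, SimpleGraph.edgeSet_fromEdgeSet, Set.mem_sdiff,
      Finset.mem_coe]
    constructor
    · exact fun h => h.1
    · intro h
      refine ⟨h, ?_⟩
      have := ht h
      rw [hU, SimpleGraph.mem_edgeFinset] at this
      simpa using this
  · intro G _
    have hsub : G.edgeFinset ⊆ U := SimpleGraph.edgeFinset_mono le_top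
    have hc : G.edgeSet.ncard = G.edgeFinset.card := by
      rw [← SimpleGraph.coe_edgeFinset, Set.ncard_coe_finset]
    rw [Finset.prod_mul_distrib, Finset.prod_const, Finset.prod_const,
      Finset.card_sdiff_of_subset hsub, hUc, Finset.prod_ite, Finset.prod_const, Finset.prod_const,
      one_pow, mul_one, Finset.filter_mem_eq_inter, gnpW, hc]
    ring

lemma gnp_total (n : ℕ) (p : ℝ) : ∑ G : SimpleGraph (Fin n), gnpW n p G = 1 := by
  classical
  have := gnp_moment n p 1 ∅ (by simp)
  simpa using this

open scoped Classical in
/-- Potential edges meeting `X` and contained in `X ∪ Y`. -/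
noncomputable def potEdges {n : ℕ} (X Y : Finset (Fin n)) : Finset (Sym2 (Fin n)) :=
  (X.offDiag.image (fun q => s(q.1, q.2)) ∪ (X ×ˢ Y).image (fun q => s(q.1, q.2))) ∩
    (⊤ : SimpleGraph (Fin n)).edgeFinset

lemma card_potEdges {n : ℕ} (X Y : Finset (Fin n)) (h : Y.card ≤ X.card) :
    ((potEdges X Y).card : ℝ) ≤ 3 / 2 * (X.card : ℝ) ^ 2 := by
  classical
  have h1 : (potEdges X Y).card ≤ X.card.choose 2 + X.card * Y.card := by
    unfold potEdges
    refine (Finset.card_le_card Finset.inter_subset_left).trans ?_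
    refine (Finset.card_union_le _ _).trans ?_
    refine add_le_add ?_ ?_
    · exact (Sym2.card_image_offDiag X).le
    · exact Finset.card_image_le.trans (Finset.card_product _ _).le
  have h2 : (X.card.choose 2 : ℝ) ≤ (X.card : ℝ) ^ 2 / 2 := by
    rw [Nat.cast_choose_two]
    have : (0 : ℝ) ≤ X.card := Nat.cast_nonneg _
    nlinarith
  have h3 : ((potEdges X Y).card : ℝ) ≤ X.card.choose 2 + X.card * Y.card := by exact_mod_cast h1
  have h4 : (X.card : ℝ) * Y.card ≤ X.card * X.card := by
    gcongr
  nlinarith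

open scoped Classical in
/-- The deterministic part. -/
lemma dense_pair {n : ℕ} (hn : 0 < n) (G : SimpleGraph (Fin n)) (D : Fin n → Fin n → Prop)
    (hD : IsOrientation G D) (c : ℝ) (hc : ∀ v, c ≤ ((firstNbhd D v).ncard : ℝ))
    (hS : ¬ HasSeymourVertex D) :
    ∃ X Y : Finset (Fin n), c ≤ X.card ∧ Y.card ≤ X.card ∧
      X.card ^ 2 ≤ (G.edgeFinset ∩ potEdges X Y).card := by
  have : Nonempty (Fin n) := ⟨⟨0, hn⟩⟩
  obtain ⟨u, hu⟩ := Finite.exists_min (fun v => (firstNbhd D v).ncard)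
  have hasym : ∀ x y, D x y → ¬ D y x := fun x y h => (hD.2 x y (hD.1 x y h)).1 h
  set X := (firstNbhd D u).toFinset with hX
  set Y := (secondNbhd D u).toFinset with hY
  have hXc : (firstNbhd D u).ncard = X.card := Set.ncard_eq_toFinset_card' _
  have hYc : (secondNbhd D u).ncard = Y.card := Set.ncard_eq_toFinset_card' _
  have hns : Y.card < X.card := by
    rw [← hXc, ← hYc]
    by_contra h
    exact hS ⟨u, not_lt.1 h⟩
  refine ⟨X, Y, hXc ▸ hc u, hns.le, ?_⟩
  have hmX : ∀ x, x ∈ X ↔ D u x := fun x => by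
    rw [hX, Set.mem_toFinset]; rfl
  have hmY : ∀ x, x ∈ Y ↔ ¬ D u x ∧ x ≠ u ∧ ∃ w, D u w ∧ D w x := fun x => by
    rw [hY, Set.mem_toFinset]; rfl
  set A : Finset (Σ _ : Fin n, Fin n) := X.sigma (fun x => (firstNbhd D x).toFinset) with hA
  have hmA : ∀ q, q ∈ A ↔ D u q.1 ∧ D q.1 q.2 := fun q => by
    rw [hA, Finset.mem_sigma, hmX, Set.mem_toFinset]; rfl
  have hAc : X.card ^ 2 ≤ A.card := by
    rw [hA, Finset.card_sigma, sq]
    refine Finset.card_nsmul_le_sum X _ _ ?_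
    intro x _
    rw [← hXc]
    exact (hu x).trans (Set.ncard_eq_toFinset_card' _).le
  refine hAc.trans ?_
  refine Finset.card_le_card_of_injOn (fun q => s(q.1, q.2)) ?_ ?_
  · rintro ⟨x, y⟩ hq
    obtain ⟨h1, h2⟩ := (hmA _).1 hq
    simp only at h1 h2
    have hadj := hD.1 _ _ h2
    have hne := hadj.ne
    simp only [Finset.coe_inter, Set.mem_inter_iff, Finset.mem_coe, SimpleGraph.mem_edgeFinset,
      SimpleGraph.mem_edgeSet]
    refine ⟨hadj, ?_⟩
    unfold potEdges
    rw [Finset.mem_inter, Finset.mem_union]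
    refine ⟨?_, by simpa using hne⟩
    by_cases hy : D u y
    · left
      exact Finset.mem_image.2 ⟨(x, y), by simp [hmX, h1, hy, hne], rfl⟩
    · right
      refine Finset.mem_image.2 ⟨(x, y), ?_, rfl⟩
      rw [Finset.mem_product]
      refine ⟨(hmX _).2 h1, (hmY _).2 ⟨hy, ?_, x, h1, h2⟩⟩
      rintro rfl
      exact hasym _ _ h1 h2
  · rintro ⟨x, y⟩ hq ⟨x', y'⟩ hq' h
    obtain ⟨h1, h2⟩ := (hmA _).1 hq
    obtain ⟨h1', h2'⟩ := (hmA _).1 hq'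
    simp only at h1 h2 h1' h2' h
    rcases Sym2.eq_iff.1 h with ⟨rfl, rfl⟩ | ⟨rfl, rfl⟩
    · rfl
    · exact absurd h2' (hasym _ _ h2)

open scoped Classical in
lemma chernoff_pair {n : ℕ} {p g : ℝ} (hp : p ∈ Set.Ioo (0 : ℝ) 1) (hg : 0 < g) (hg1 : g ≤ 1)
    (hpg : 3 / 2 * p ≤ 1 - g) (X Y : Finset (Fin n)) (h : Y.card ≤ X.card)
    (hX : 4 / g * Real.sqrt n ≤ X.card) :
    ∑ G : SimpleGraph (Fin n), gnpW n p G *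
      (Real.exp (g / 2) ^ (G.edgeFinset ∩ potEdges X Y).card / Real.exp (g / 2) ^ (X.card ^ 2))
      ≤ (1 / 16) ^ n := by
  have e1 : ∑ G : SimpleGraph (Fin n), gnpW n p G *
      (Real.exp (g / 2) ^ (G.edgeFinset ∩ potEdges X Y).card / Real.exp (g / 2) ^ (X.card ^ 2))
      = (1 - p + p * Real.exp (g / 2)) ^ (potEdges X Y).card / Real.exp (g / 2) ^ (X.card ^ 2) := by
    rw [← gnp_moment n p _ (potEdges X Y) Finset.inter_subset_right, Finset.sum_div]
    exact Finset.sum_congr rfl fun _ _ => by ring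
  rw [e1]
  set l := g / 2 with hl
  have hl0 : 0 < l := by positivity
  have ha : Real.exp l - 1 ≤ l + l ^ 2 := by
    have := abs_le.1 (Real.abs_exp_sub_one_sub_id_le (x := l) (by rw [abs_of_pos hl0]; linarith))
    linarith [this.2]
  have ha0 : 0 ≤ Real.exp l - 1 := by linarith [Real.add_one_le_exp l]
  have hb : 1 - p + p * Real.exp l ≤ Real.exp (p * (Real.exp l - 1)) := by
    have := Real.add_one_le_exp (p * (Real.exp l - 1))
    linarith
  have hb0 : 0 ≤ 1 - p + p * Real.exp l := by
    have := hp.1; have := hp.2; have := Real.exp_pos l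
    have : 0 < p * Real.exp l := by positivity
    linarith
  have hs := card_potEdges X Y h
  set s := (potEdges X Y).card
  set d := X.card
  have hd : 16 / g ^ 2 * n ≤ (d : ℝ) ^ 2 := by
    have h0 : 0 ≤ 4 / g * Real.sqrt n := by positivity
    have := pow_le_pow_left₀ h0 hX 2
    rw [mul_pow, Real.sq_sqrt (Nat.cast_nonneg _), div_pow] at this
    norm_num at this
    exact this
  have key : (s : ℝ) * (p * (Real.exp l - 1)) - (d : ℝ) ^ 2 * l ≤ -4 * n := by
    have hp0 := hp.1.le
    have k1 : (s : ℝ) * (p * (Real.exp l - 1)) ≤ 3 / 2 * (d : ℝ) ^ 2 * (p * (l + l ^ 2)) := by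
      gcongr
    have k2 : 3 / 2 * (d : ℝ) ^ 2 * (p * (l + l ^ 2)) ≤ (d : ℝ) ^ 2 * ((1 - g) * (l + l ^ 2)) := by
      have : 3 / 2 * (d : ℝ) ^ 2 * (p * (l + l ^ 2)) = (d : ℝ) ^ 2 * ((3 / 2 * p) * (l + l ^ 2)) := by
        ring
      rw [this]
      gcongr
    have k3 : (d : ℝ) ^ 2 * ((1 - g) * (l + l ^ 2)) - (d : ℝ) ^ 2 * l
        ≤ (d : ℝ) ^ 2 * (- (g ^ 2 / 4)) := by
      rw [← mul_sub]
      refine mul_le_mul_of_nonneg_left ?_ (by positivity)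
      have : 0 ≤ g ^ 3 := by positivity
      rw [hl]
      nlinarith
    have k4 : 16 / g ^ 2 * n * (g ^ 2 / 4) ≤ (d : ℝ) ^ 2 * (g ^ 2 / 4) := by gcongr
    have k5 : 16 / g ^ 2 * n * (g ^ 2 / 4) = 4 * n := by
      field_simp
      ring
    linarith
  calc (1 - p + p * Real.exp l) ^ s / Real.exp l ^ (d ^ 2)
      ≤ Real.exp (p * (Real.exp l - 1)) ^ s / Real.exp l ^ (d ^ 2) := by gcongr
    _ = Real.exp ((s : ℝ) * (p * (Real.exp l - 1)) - (d : ℝ) ^ 2 * l) := by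
        rw [Real.exp_sub, Real.exp_nat_mul, ← Real.exp_nat_mul l (d ^ 2)]
        push_cast
        rfl
    _ ≤ Real.exp (-4 * n) := Real.exp_le_exp.2 key
    _ = Real.exp (-4) ^ n := by rw [mul_comm, Real.exp_nat_mul]
    _ ≤ (1 / 16) ^ n := by
        refine pow_le_pow_left₀ (Real.exp_pos _).le ?_ n
        have h2 : (2 : ℝ) ≤ Real.exp 1 := by linarith [Real.add_one_le_exp (1 : ℝ)]
        have h4 : Real.exp 4 = Real.exp 1 ^ 4 := by rw [← Real.exp_nat_mul]; norm_num
        have h16 : (16 : ℝ) ≤ Real.exp 4 := by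
          rw [h4]
          calc (16 : ℝ) = 2 ^ 4 := by norm_num
            _ ≤ _ := by gcongr
        rw [Real.exp_neg, ← one_div]
        gcongr

open scoped Classical in
lemma gnp_bound {n : ℕ} (hn : 0 < n) {p g : ℝ} (hp : p ∈ Set.Ioo (0 : ℝ) 1) (hg : 0 < g)
    (hg1 : g ≤ 1) (hpg : 3 / 2 * p ≤ 1 - g) (S : Set (SimpleGraph (Fin n)))
    (hS : S = {G | ∀ D : Fin n → Fin n → Prop, IsOrientation G D →
            (∀ v, 4 / g * Real.sqrt n ≤ ((firstNbhd D v).ncard : ℝ)) → HasSeymourVertex D}) :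
    1 - (1 / 4) ^ n ≤ gnpProb n p S ∧ gnpProb n p S ≤ 1 := by
  have hprob : gnpProb n p S = ∑ G, if G ∈ S then gnpW n p G else 0 := rfl
  have hcompl : gnpProb n p S + ∑ G, (if G ∈ S then 0 else gnpW n p G) = 1 := by
    rw [hprob, ← Finset.sum_add_distrib, ← gnp_total n p]
    refine Finset.sum_congr rfl fun G _ => ?_
    split_ifs <;> simp
  have hnn : 0 ≤ ∑ G, (if G ∈ S then 0 else gnpW n p G) := by
    refine Finset.sum_nonneg fun G _ => ?_
    split_ifs
    · exact le_rfl
    · exact gnpW_nonneg hp G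
  refine ⟨?_, by linarith⟩
  suffices hbad : ∑ G, (if G ∈ S then 0 else gnpW n p G) ≤ (1 / 4) ^ n by linarith
  set F : Finset (Finset (Fin n) × Finset (Fin n)) := Finset.univ.filter
    (fun q => q.2.card ≤ q.1.card ∧ 4 / g * Real.sqrt n ≤ q.1.card) with hF
  set T : SimpleGraph (Fin n) → Finset (Fin n) × Finset (Fin n) → ℝ := fun G q =>
    Real.exp (g / 2) ^ (G.edgeFinset ∩ potEdges q.1 q.2).card /
      Real.exp (g / 2) ^ (q.1.card ^ 2) with hT
  have hT0 : ∀ G q, 0 ≤ T G q := fun G q => by positivity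
  have hFc : (F.card : ℝ) ≤ 4 ^ n := by
    have : F.card ≤ 2 ^ n * 2 ^ n := by
      refine (Finset.card_le_univ _).trans ?_
      simp [Fintype.card_prod]
    have h2 : (F.card : ℝ) ≤ 2 ^ n * 2 ^ n := by exact_mod_cast this
    rw [← mul_pow] at h2
    norm_num at h2
    exact h2
  calc ∑ G, (if G ∈ S then 0 else gnpW n p G) ≤ ∑ G, ∑ q ∈ F, gnpW n p G * T G q := by
        refine Finset.sum_le_sum fun G _ => ?_
        have hw := gnpW_nonneg hp G
        split_ifs with hG
        · exact Finset.sum_nonneg fun q _ => mul_nonneg hw (hT0 G q)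
        · rw [hS, Set.mem_ofPred_eq] at hG
          push Not at hG
          obtain ⟨D, hD, hmin, hno⟩ := hG
          obtain ⟨X, Y, h1, h2, h3⟩ := dense_pair hn G D hD _ hmin hno
          have hm : (X, Y) ∈ F := by simp only [hF, Finset.mem_filter]; exact ⟨Finset.mem_univ _, h2, h1⟩
          refine le_trans ?_ (Finset.single_le_sum (f := fun q => gnpW n p G * T G q)
            (fun q _ => mul_nonneg hw (hT0 G q)) hm)
          refine le_mul_of_one_le_right hw ?_
          simp only [hT]
          rw [one_le_div (by positivity)]
          exact pow_le_pow_right₀ (Real.one_le_exp (by positivity)) h3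
    _ = ∑ q ∈ F, ∑ G, gnpW n p G * T G q := Finset.sum_comm
    _ ≤ ∑ q ∈ F, (1 / 16 : ℝ) ^ n := by
        refine Finset.sum_le_sum fun q hq => ?_
        obtain ⟨-, h1, h2⟩ := Finset.mem_filter.1 hq
        exact chernoff_pair hp hg hg1 hpg q.1 q.2 h1 h2
    _ = F.card * (1 / 16 : ℝ) ^ n := by simp
    _ ≤ 4 ^ n * (1 / 16 : ℝ) ^ n := by gcongr
    _ = (1 / 4) ^ n := by rw [← mul_pow]; norm_num

/-- For every `β > 0` there is `C = C(β)` such that if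
`limsup p ≤ 2/3 − β`, then a.a.s. every orientation of `G(n, p(n))` with minimum
outdegree at least `C √n` contains a Seymour vertex. -/
theorem snc_gnp_min_outdegree (β : ℝ) (hβ : 0 < β) :
    ∃ C : ℝ, ∀ p : ℕ → ℝ, (∀ n, p n ∈ Set.Ioo (0 : ℝ) 1) →
      Filter.limsup p Filter.atTop ≤ 2 / 3 - β →
      Filter.Tendsto
        (fun n => gnpProb n (p n)
          {G | ∀ D : Fin n → Fin n → Prop, IsOrientation G D →
            (∀ v, C * Real.sqrt n ≤ ((firstNbhd D v).ncard : ℝ)) → HasSeymourVertex D})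
        Filter.atTop (nhds 1) := by
  set g : ℝ := min β 1 / 2 with hg
  have hm : 0 < min β 1 := lt_min hβ one_pos
  have hg0 : 0 < g := by positivity
  have hg1 : g ≤ 1 := by linarith [min_le_right β 1]
  have hgβ : g ≤ β / 2 := by linarith [min_le_left β 1]
  refine ⟨4 / g, fun p hp hlim => ?_⟩
  have hev : ∀ᶠ n in Filter.atTop, p n < 2 / 3 - β / 2 := by
    refine Filter.eventually_lt_of_limsup_lt (by linarith) ?_
    exact Filter.isBoundedUnder_of ⟨1, fun n => (hp n).2.le⟩
  have hb : ∀ᶠ n in Filter.atTop, 1 - (1 / 4 : ℝ) ^ n ≤ gnpProb n (p n)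
      {G | ∀ D : Fin n → Fin n → Prop, IsOrientation G D →
        (∀ v, 4 / g * Real.sqrt n ≤ ((firstNbhd D v).ncard : ℝ)) → HasSeymourVertex D} ∧
      gnpProb n (p n)
      {G | ∀ D : Fin n → Fin n → Prop, IsOrientation G D →
        (∀ v, 4 / g * Real.sqrt n ≤ ((firstNbhd D v).ncard : ℝ)) → HasSeymourVertex D} ≤ 1 := by
    filter_upwards [hev, Filter.eventually_gt_atTop 0] with n h1 h2
    exact gnp_bound h2 (hp n) hg0 hg1 (by linarith) _ rfl
  have hlow : Filter.Tendsto (fun n : ℕ => 1 - (1 / 4 : ℝ) ^ n) Filter.atTop (nhds 1) := by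
    have := (tendsto_pow_atTop_nhds_zero_of_lt_one (r := (1 / 4 : ℝ)) (by norm_num)
      (by norm_num)).const_sub 1
    simpa using this
  exact tendsto_of_tendsto_of_tendsto_of_le_of_le' hlow tendsto_const_nhds
    (hb.mono fun _ h => h.1) (hb.mono fun _ h => h.2)
end

section
/- Every locally cornering digraph contains a Seymour vertex. -/
/-- A digraph is locally cornering if the out-neighborhood of each vertex, whenever
nonempty, induces a subdigraph with a sink (a vertex with no outgoing arcs inside it). -/
def LocallyCornering {V : Type*} (D : V → V → Prop) : Prop :=
  ∀ u : V, (∃ v, D u v) → ∃ v, D u v ∧ ∀ w, D u w → ¬ D v w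

/-- Every (finite, nonempty) locally cornering digraph contains a
Seymour vertex. -/
theorem locally_cornering_has_seymour {V : Type*} [Fintype V] [Nonempty V]
    (D : V → V → Prop) (hD : ∀ u v, D u v → ¬ D v u) (h : LocallyCornering D) :
    HasSeymourVertex D := by
  obtain ⟨u, hu⟩ := Finite.exists_min (fun u => (firstNbhd D u).ncard)
  refine ⟨u, ?_⟩
  unfold IsSeymourVertex
  by_cases hne : ∃ v, D u v
  · obtain ⟨v, huv, hv⟩ := h u hne
    refine (hu v).trans (Set.ncard_le_ncard ?_ (Set.toFinite _))
    intro w hw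
    refine ⟨fun huw => hv w huw hw, ?_, v, huv, hw⟩
    rintro rfl
    exact hD _ _ huv hw
  · have he : firstNbhd D u = ∅ := by
      ext v
      simp only [firstNbhd, Set.mem_setOf_eq, Set.mem_empty_iff_false, iff_false]
      exact fun hv => hne ⟨v, hv⟩
    simp [he]
end

section
/- In a locally cornering digraph (with a nonempty finite vertex set), every vertex of minimum outdegree is a Seymour vertex. -/
/-- In a (finite, nonempty) locally cornering digraph, every vertex of
minimum outdegree is a Seymour vertex. -/
theorem locally_cornering_min_outdegree_seymour {V : Type*} [Fintype V] [Nonempty V]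
    (D : V → V → Prop) (hD : ∀ u v, D u v → ¬ D v u) (h : LocallyCornering D)
    (u : V) (hu : ∀ v, (firstNbhd D u).ncard ≤ (firstNbhd D v).ncard) :
    IsSeymourVertex D u := by
  unfold IsSeymourVertex
  by_cases hne : ∃ v, D u v
  · obtain ⟨v, huv, hv⟩ := h u hne
    refine (hu v).trans (Set.ncard_le_ncard ?_ (Set.toFinite _))
    intro w hw
    refine ⟨fun huw => hv w huw hw, ?_, v, huv, hw⟩
    rintro rfl
    exact hD _ _ huv hw
  · have h0 : firstNbhd D u = ∅ := by
      ext w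
      exact ⟨fun hw => hne ⟨w, hw⟩, fun hw => hw.elim⟩
    rw [h0, Set.ncard_empty]
    exact Nat.zero_le _
end

section
/- Every orientation of a wheel-free graph contains a Seymour vertex. -/
/-- `G` contains a wheel as a subgraph: there is a cycle together with a vertex
adjacent to all vertices of the cycle. -/
def HasWheel {V : Type*} (G : SimpleGraph V) : Prop :=
  ∃ (w v : V) (c : G.Walk v v), c.IsCycle ∧ ∀ x ∈ c.support, G.Adj w x

theorem acyclic_no_functional {W : Type*} [Finite W] [Nonempty W] (H : SimpleGraph W)
    (hH : H.IsAcyclic) (f : W → W) (hf : ∀ w, H.Adj w (f w)) (hff : ∀ w, f (f w) ≠ w) : False := by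
  classical
  have := Fintype.ofFinite W
  obtain ⟨T, hHT, -, hT⟩ := (SimpleGraph.connected_top (V := W)).exists_isTree_le_of_le_of_isAcyclic
    le_top hH
  have h1 := (SimpleGraph.isTree_iff_connected_and_card.1 hT).2
  have h2 : Nat.card W ≤ Nat.card T.edgeSet := by
    refine Nat.card_le_card_of_injective
      (fun w => (⟨s(w, f w), hHT (hf w)⟩ : T.edgeSet)) ?_
    intro v w hvw
    have h3 : s(v, f v) = s(w, f w) := congrArg Subtype.val hvw
    rcases Sym2.eq_iff.1 h3 with ⟨h, -⟩ | ⟨h, h'⟩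
    · exact h
    · exact absurd (by rw [← h, h']) (hff w)
  omega

/-- In a wheel-free graph, a nonempty out-neighborhood has a sink. -/
theorem exists_sink {V : Type*} [Fintype V] (G : SimpleGraph V) (hG : ¬ HasWheel G)
    (D : V → V → Prop) (hD : IsOrientation G D) (u : V) (hu : ∃ v, D u v) :
    ∃ v, D u v ∧ ∀ x, D u x → ¬ D v x := by
  by_contra! hcon
  obtain ⟨v0, hv0⟩ := hu
  have : Nonempty {v | D u v} := ⟨⟨v0, hv0⟩⟩
  choose g hg1 hg2 using hcon
  refine acyclic_no_functional (G.induce {v | D u v}) ?_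
    (fun w => ⟨g w.1 w.2, hg1 w.1 w.2⟩) ?_ ?_
  · intro v c hc
    refine hG ⟨u, _, c.map (SimpleGraph.Embedding.induce _).toHom,
      hc.map Subtype.val_injective, ?_⟩
    intro x hx
    rw [SimpleGraph.Walk.support_map, List.mem_map] at hx
    obtain ⟨y, -, rfl⟩ := hx
    exact hD.1 _ _ y.2
  · intro w
    exact hD.1 _ _ (hg2 w.1 w.2)
  · intro w hw
    have h1 := hg2 w.1 w.2
    have h2 := hg2 _ (hg1 w.1 w.2)
    rw [show g (g w.1 w.2) (hg1 w.1 w.2) = w.1 from congrArg Subtype.val hw] at h2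
    exact (hD.2 _ _ (hD.1 _ _ h1)).1 h1 h2

/-- Every orientation of a (finite, nonempty) wheel-free graph contains
a Seymour vertex. -/
theorem orientation_of_wheel_free_has_seymour {V : Type*} [Fintype V] [Nonempty V]
    (G : SimpleGraph V) (hG : ¬ HasWheel G)
    (D : V → V → Prop) (hD : IsOrientation G D) :
    HasSeymourVertex D := by
  obtain ⟨u, hu⟩ := Finite.exists_min (fun u => (firstNbhd D u).ncard)
  refine ⟨u, ?_⟩
  unfold IsSeymourVertex
  by_cases hne : ∃ v, D u v
  · obtain ⟨v, huv, hv⟩ := exists_sink G hG D hD u hne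
    refine (hu v).trans (Set.ncard_le_ncard ?_ (Set.toFinite _))
    intro x hx
    refine ⟨fun h => hv x h hx, ?_, v, huv, hx⟩
    rintro rfl
    exact (hD.2 _ _ (hD.1 _ _ huv)).1 huv hx
  · have : firstNbhd D u = ∅ := by
      ext v
      simpa [firstNbhd] using fun h => hne ⟨v, h⟩
    simp [this]
end

section
/- Let p ∈ (0,1) and let G be a graph of order n satisfying: for every X ⊆ V(G), |e(X) − C(|X|,2)·p| ≤ |X|·√(3np(1−p)) + 2n, where e(X) is the number of edges inside X. Fix a ∈ ℕ, let D be an orientation of G and let B = {v ∈ V(D) : deg⁺_D(v) < a}. If B is nonempty, then |B| ≤ (2/p)(a−1) + 1 + √(12n(1−p)/p) + 4n/(|B|·p). -/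
/-- The number of edges of `G` with both endpoints in `X`. -/
noncomputable def edgesIn {V : Type*} (G : SimpleGraph V) (X : Set V) : ℕ :=
  {e ∈ G.edgeSet | ∀ v ∈ e, v ∈ X}.ncard

/-- The number of edges of `G` with one endpoint in `X` and the other in `Y`. -/
noncomputable def edgesBetween {V : Type*} (G : SimpleGraph V) (X Y : Set V) : ℕ :=
  {e ∈ G.edgeSet | ∃ x ∈ X, ∃ y ∈ Y, e = s(x, y)}.ncard

/-- If a graph `G` of order `n` satisfies condition (1) of
`p`-typicality, `D` is an orientation of `G`, and `B` is the (nonempty) set of vertices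
of outdegree less than `a`, then `|B| ≤ (2/p)(a−1) + 1 + √(12n(1−p)/p) + 4n/(|B|p)`. -/
theorem small_outdegree_set_bound (n : ℕ) (p : ℝ) (hp : p ∈ Set.Ioo (0 : ℝ) 1)
    (G : SimpleGraph (Fin n))
    (h1 : ∀ X : Set (Fin n),
      |(edgesIn G X : ℝ) - (X.ncard.choose 2 : ℝ) * p| ≤
        (X.ncard : ℝ) * Real.sqrt (3 * n * p * (1 - p)) + 2 * n)
    (a : ℕ) (D : Fin n → Fin n → Prop) (hD : IsOrientation G D)
    (B : Set (Fin n)) (hB : B = {v | (firstNbhd D v).ncard < a}) (hBne : B.Nonempty) :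
    (B.ncard : ℝ) ≤ 2 / p * ((a : ℝ) - 1) + 1 + Real.sqrt (12 * n * (1 - p) / p)
      + 4 * n / (B.ncard * p) := by
  classical
  obtain ⟨hp0, hp1⟩ := hp
  have hbpos : 0 < B.ncard := (Set.ncard_pos (Set.toFinite B)).2 hBne
  have ha : 1 ≤ a := by
    obtain ⟨v, hv⟩ := hBne
    rw [hB] at hv
    have : (firstNbhd D v).ncard < a := hv
    omega
  have hE : edgesIn G B ≤ B.ncard * (a - 1) := by
    have hsub : {e ∈ G.edgeSet | ∀ v ∈ e, v ∈ B} ⊆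
        ((B.toFinset.biUnion fun v => (firstNbhd D v).toFinset.image fun w => s(v, w) :
          Finset (Sym2 (Fin n))) : Set (Sym2 (Fin n))) := by
      rintro e ⟨he, hv⟩
      induction e using Sym2.ind with
      | _ x y =>
        have hadj : G.Adj x y := he
        have hx : x ∈ B := hv x (Sym2.mem_mk_left x y)
        have hy : y ∈ B := hv y (Sym2.mem_mk_right x y)
        rw [Finset.mem_coe, Finset.mem_biUnion]
        by_cases h : D x y
        · exact ⟨x, by simpa using hx, Finset.mem_image.2 ⟨y, Set.mem_toFinset.2 h, rfl⟩⟩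
        · have h' : D y x := by
            by_contra h2
            exact h ((hD.2 x y hadj).2 h2)
          exact ⟨y, by simpa using hy,
            Finset.mem_image.2 ⟨x, Set.mem_toFinset.2 h', Sym2.eq_swap⟩⟩
    have h2 := Set.ncard_le_ncard hsub (Finset.finite_toSet _)
    rw [Set.ncard_coe_finset] at h2
    refine h2.trans ?_
    rw [Set.ncard_eq_toFinset_card' B]
    apply Finset.card_biUnion_le_card_mul
    intro v hv
    refine Finset.card_image_le.trans ?_
    rw [← Set.ncard_eq_toFinset_card']
    have hv' : v ∈ B := by simpa using hv
    rw [hB] at hv'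
    have : (firstNbhd D v).ncard < a := hv'
    omega
  have hE' : (edgesIn G B : ℝ) ≤ B.ncard * ((a : ℝ) - 1) := by
    have : ((edgesIn G B : ℕ) : ℝ) ≤ ((B.ncard * (a - 1) : ℕ) : ℝ) := by exact_mod_cast hE
    rwa [Nat.cast_mul, Nat.cast_sub ha, Nat.cast_one] at this
  have h := (abs_le.1 (h1 B)).1
  rw [Nat.cast_choose_two] at h
  have hs : Real.sqrt (12 * n * (1 - p) / p) = 2 / p * Real.sqrt (3 * n * p * (1 - p)) := by
    have h0 : (0 : ℝ) ≤ 2 / p := by positivity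
    rw [← Real.sqrt_sq h0, ← Real.sqrt_mul (sq_nonneg _)]
    congr 1
    field_simp
    ring
  rw [hs]
  generalize Real.sqrt (3 * n * p * (1 - p)) = s at *
  have hb : (0 : ℝ) < B.ncard := by exact_mod_cast hbpos
  generalize (B.ncard : ℝ) = b at *
  have key : b * p * (b - 1) ≤ 2 * b * ((a : ℝ) - 1) + 2 * b * s + 4 * n := by linarith
  have hbp : 0 < b * p := by positivity
  have key2 : b - 1 ≤ (2 * b * ((a : ℝ) - 1) + 2 * b * s + 4 * n) / (b * p) := by
    rw [le_div_iff₀ hbp]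
    linarith
  have e : (2 * b * ((a : ℝ) - 1) + 2 * b * s + 4 * n) / (b * p)
      = 2 / p * ((a : ℝ) - 1) + 2 / p * s + 4 * n / (b * p) := by
    field_simp
  linarith
end

section
/- There exists a universal constant C > 1 such that for all A ≥ 2 and all ε, p ∈ (0,1) with ε³np² ≥ A²C, every weakly (p, A√(np))-bijumbled graph G of order n satisfies: the number of vertices v with |deg(v) − np| > ε·np is at most ε·n. -/
/-- A graph `G` of order `n` is weakly `(p, α)`-bijumbled if all pairs of disjoint sets
`U`, `W` with `1 ≤ |U| ≤ |W| ≤ np|U|` satisfy `|e(U,W) − p|U||W|| ≤ α √(|U||W|)`. -/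
def WeaklyBijumbled {V : Type*} [Fintype V] (G : SimpleGraph V) (p α : ℝ) : Prop :=
  ∀ U W : Set V, Disjoint U W → 1 ≤ U.ncard → U.ncard ≤ W.ncard →
    (W.ncard : ℝ) ≤ (Fintype.card V : ℝ) * p * U.ncard →
    |(edgesBetween G U W : ℝ) - p * U.ncard * W.ncard| ≤
      α * Real.sqrt (U.ncard * W.ncard)

/-- The degree of `v` in `G`. -/
noncomputable def deg {V : Type*} (G : SimpleGraph V) (v : V) : ℕ := (G.neighborSet v).ncard

/-- The codegree of `u` and `v` in `G`: the number of their common neighbors. -/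
noncomputable def codeg {V : Type*} (G : SimpleGraph V) (u v : V) : ℕ :=
  (G.neighborSet u ∩ G.neighborSet v).ncard

/-- Condition (1) of `p`-typicality: the edge count of every vertex subset is close to
its expectation. -/
def PTypical1 (n : ℕ) (p : ℝ) (G : SimpleGraph (Fin n)) : Prop :=
  ∀ X : Set (Fin n),
    |(edgesIn G X : ℝ) - (X.ncard.choose 2 : ℝ) * p| ≤
      (X.ncard : ℝ) * Real.sqrt (3 * n * p * (1 - p)) + 2 * n

/-- Condition (2) of `p`-typicality. -/
def PTypical2 (n : ℕ) (p : ℝ) (G : SimpleGraph (Fin n)) : Prop :=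
  ∀ n' n'' : ℝ, ((n' * Real.log n ≤ n'' ∧ n'' ≤ n) ∨ (n' = n ∧ n'' = n)) →
    ∀ X Y : Set (Fin n), (X.ncard : ℝ) ≤ n' → (Y.ncard : ℝ) ≤ n' →
      |(edgesBetween G X Y : ℝ) - (X.ncard : ℝ) * Y.ncard * p| ≤
        Real.sqrt (6 * n'' * p * (1 - p) * X.ncard * Y.ncard) + 2 * n''

/-- Condition (3) of `p`-typicality: all degrees are close to `np`. -/
def PTypical3 (n : ℕ) (p : ℝ) (G : SimpleGraph (Fin n)) : Prop :=
  ∀ v : Fin n,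
    |(deg G v : ℝ) - n * p| ≤ Real.sqrt (6 * n * p * (1 - p) * Real.log n) + 2 * Real.log n

/-- Condition (4) of `p`-typicality: all codegrees are close to `(n-2)p²`. -/
def PTypical4 (n : ℕ) (p : ℝ) (G : SimpleGraph (Fin n)) : Prop :=
  ∀ u v : Fin n, u ≠ v →
    |(codeg G u v : ℝ) - ((n : ℝ) - 2) * p ^ 2| ≤
      Real.sqrt (6 * n * p ^ 2 * (1 - p ^ 2) * Real.log n) + 2 * Real.log n

/-- A graph of order `n` is `p`-typical if it satisfies all four conditions. -/
def PTypical (n : ℕ) (p : ℝ) (G : SimpleGraph (Fin n)) : Prop :=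
  PTypical1 n p G ∧ PTypical2 n p G ∧ PTypical3 n p G ∧ PTypical4 n p G

open Classical in
/-- signed edge discrepancy kernel -/
noncomputable def dk {n : ℕ} (G : SimpleGraph (Fin n)) (p : ℝ) (x y : Fin n) : ℝ :=
  (if G.Adj x y then 1 else 0) - p

open Classical in
lemma edgesBetween_eq {n : ℕ} (G : SimpleGraph (Fin n)) (U W : Finset (Fin n))
    (h : Disjoint U W) :
    edgesBetween G (U : Set (Fin n)) (W : Set (Fin n)) =
      ((U ×ˢ W).filter (fun q => G.Adj q.1 q.2)).card := by
  unfold edgesBetween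
  rw [← Set.ncard_coe_finset]
  have himg : {e ∈ G.edgeSet | ∃ x ∈ (U : Set (Fin n)), ∃ y ∈ (W : Set (Fin n)), e = s(x, y)} =
      Set.image (fun q : Fin n × Fin n => s(q.1, q.2))
        (((U ×ˢ W).filter (fun q => G.Adj q.1 q.2) : Finset _) : Set (Fin n × Fin n)) := by
    ext e
    simp only [Set.mem_setOf_eq, Set.mem_image, Finset.coe_filter, Finset.mem_product,
      Finset.mem_coe, Prod.exists]
    constructor
    · rintro ⟨he, x, hx, y, hy, rfl⟩
      exact ⟨x, y, ⟨⟨hx, hy⟩, he⟩, rfl⟩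
    · rintro ⟨x, y, ⟨⟨hx, hy⟩, he⟩, rfl⟩
      exact ⟨he, x, hx, y, hy, rfl⟩
  rw [himg, Set.ncard_image_of_injOn]
  rintro ⟨a, b⟩ hab ⟨c, d⟩ hcd heq
  simp only [Finset.coe_filter, Finset.mem_product, Set.mem_setOf_eq] at hab hcd
  simp only [Sym2.eq_iff] at heq
  rcases heq with ⟨rfl, rfl⟩ | ⟨rfl, rfl⟩
  · rfl
  · exact absurd hcd.1.2 (Finset.disjoint_left.mp h hab.1.1)

lemma edgesBetween_swap {n : ℕ} (G : SimpleGraph (Fin n)) (U W : Set (Fin n)) :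
    edgesBetween G U W = edgesBetween G W U := by
  unfold edgesBetween
  congr 1
  ext e
  constructor
  · rintro ⟨he, x, hx, y, hy, rfl⟩
    exact ⟨he, y, hy, x, hx, Sym2.eq_swap⟩
  · rintro ⟨he, x, hx, y, hy, rfl⟩
    exact ⟨he, y, hy, x, hx, Sym2.eq_swap⟩

lemma sum_dk_eq {n : ℕ} (G : SimpleGraph (Fin n)) (p : ℝ) (U W : Finset (Fin n))
    (h : Disjoint U W) :
    ∑ x ∈ U, ∑ y ∈ W, dk G p x y =
      (edgesBetween G (U : Set (Fin n)) (W : Set (Fin n)) : ℝ) - p * U.card * W.card := by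
  classical
  rw [edgesBetween_eq G U W h, ← Finset.sum_product']
  simp only [dk, Finset.sum_sub_distrib, Finset.sum_const, Finset.card_product,
    Finset.sum_boole, nsmul_eq_mul]
  push_cast
  ring_nf

lemma disc_aux {n : ℕ} (G : SimpleGraph (Fin n)) (p α : ℝ) (hp : 0 < p) (hp1 : p < 1)
    (hα : 0 ≤ α) (hG : WeaklyBijumbled G p α) (U W : Finset (Fin n)) (h : Disjoint U W)
    (hUW : U.card ≤ W.card) :
    |(edgesBetween G (U : Set (Fin n)) (W : Set (Fin n)) : ℝ) - p * U.card * W.card| ≤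
      α * Real.sqrt (U.card * W.card) + n / p := by
  classical
  have hs : 0 ≤ α * Real.sqrt (U.card * W.card) := by positivity
  have hnp : (0 : ℝ) ≤ n / p := by positivity
  have hWn : (W.card : ℝ) ≤ n := by
    have := Finset.card_le_univ W
    simp only [Fintype.card_fin] at this
    exact_mod_cast this
  by_cases hc : 1 ≤ U.card ∧ (W.card : ℝ) ≤ n * p * U.card
  · have := hG U W (by exact_mod_cast h) (by simpa using hc.1) (by simpa using hUW)
      (by simpa using hc.2)
    simp only [Set.ncard_coe_finset] at this
    linarith
  · have he : (edgesBetween G (U : Set (Fin n)) (W : Set (Fin n)) : ℝ) ≤ U.card * W.card := by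
      rw [edgesBetween_eq G U W h]
      have := Finset.card_filter_le (U ×ˢ W) (fun q => G.Adj q.1 q.2)
      rw [Finset.card_product] at this
      exact_mod_cast this
    have he0 : (0 : ℝ) ≤ edgesBetween G (U : Set (Fin n)) (W : Set (Fin n)) := by positivity
    have hU0 : (0 : ℝ) ≤ U.card := by positivity
    have hW0 : (0 : ℝ) ≤ W.card := by positivity
    have hprod : (U.card : ℝ) * W.card ≤ n / p := by
      rw [le_div_iff₀ hp]
      by_cases h1 : 1 ≤ U.card
      · have h2 : (n : ℝ) * p * U.card < W.card := by
          by_contra h3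
          exact hc ⟨h1, not_lt.mp h3⟩
        have hn : (0 : ℝ) ≤ n := by positivity
        have : p * (U.card : ℝ) * W.card ≤ p * U.card * n := by gcongr
        nlinarith
      · have : U.card = 0 := by omega
        simp [this]
    have hUWn : (0 : ℝ) ≤ U.card * W.card := by positivity
    rw [abs_le]
    constructor <;> nlinarith

lemma disc_bound {n : ℕ} (G : SimpleGraph (Fin n)) (p α : ℝ) (hp : 0 < p) (hp1 : p < 1)
    (hα : 0 ≤ α) (hG : WeaklyBijumbled G p α) (U W : Finset (Fin n)) (h : Disjoint U W) :
    |∑ x ∈ U, ∑ y ∈ W, dk G p x y| ≤ α * Real.sqrt (U.card * W.card) + n / p := by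
  rw [sum_dk_eq G p U W h]
  rcases le_total U.card W.card with h1 | h1
  · exact disc_aux G p α hp hp1 hα hG U W h h1
  · have := disc_aux G p α hp hp1 hα hG W U h.symm h1
    rw [edgesBetween_swap, mul_comm (U.card : ℝ), mul_right_comm]
    exact this

lemma row_sum {n : ℕ} (G : SimpleGraph (Fin n)) (p : ℝ) (x : Fin n) :
    ∑ y, (if x ≠ y then dk G p x y else 0) = (deg G x : ℝ) - p * (n - 1) := by
  classical
  have h1 : ∀ y, (if x ≠ y then dk G p x y else 0) =
      (if G.Adj x y then (1 : ℝ) else 0) - p + (if x = y then p else 0) := by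
    intro y
    unfold dk
    by_cases hxy : x = y
    · subst hxy; simp
    · simp [hxy]
  simp only [h1, Finset.sum_add_distrib, Finset.sum_sub_distrib, Finset.sum_boole,
    Finset.sum_ite_eq, Finset.sum_const, Finset.card_univ, Fintype.card_fin, nsmul_eq_mul,
    Finset.mem_univ, if_true]
  have : deg G x = (Finset.univ.filter (fun y => G.Adj x y)).card := by
    unfold deg
    rw [← Set.ncard_coe_finset]
    congr 1
    ext y; simp
  rw [this]
  ring

lemma count_sep {n : ℕ} (x y : Fin n) (hxy : x ≠ y) :
    ((Finset.univ : Finset (Finset (Fin n))).filter (fun X => x ∈ X ∧ y ∉ X)).card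
      = 2 ^ (n - 2) := by
  have : (Finset.univ : Finset (Finset (Fin n))).filter (fun X => x ∈ X ∧ y ∉ X) =
      Finset.Icc {x} (Finset.univ.erase y) := by
    ext X
    simp only [Finset.mem_filter, Finset.mem_univ, true_and, Finset.mem_Icc,
      Finset.singleton_subset_iff, Finset.subset_erase,
      Finset.subset_univ]
  rw [this, Finset.card_Icc_finset]
  · simp [Nat.sub_sub]
  · simp [hxy]

lemma avg_bound {n : ℕ} (hn : 2 ≤ n) (G : SimpleGraph (Fin n)) (p α : ℝ) (hp : 0 < p)
    (hp1 : p < 1) (hα : 0 ≤ α) (hG : WeaklyBijumbled G p α) (U : Finset (Fin n)) :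
    |∑ x ∈ U, ((deg G x : ℝ) - p * (n - 1))| ≤
      4 * (α * Real.sqrt (U.card * n) + n / p) := by
  classical
  have key : ∑ X : Finset (Fin n), ∑ x ∈ U ∩ X, ∑ y ∈ Xᶜ, dk G p x y =
      2 ^ (n - 2) * ∑ x ∈ U, ((deg G x : ℝ) - p * (n - 1)) := by
    have h1 : ∀ X : Finset (Fin n), ∑ x ∈ U ∩ X, ∑ y ∈ Xᶜ, dk G p x y =
        ∑ x ∈ U, ∑ y, if x ∈ X ∧ y ∉ X then dk G p x y else 0 := by
      intro X
      rw [← Finset.filter_mem_eq_inter, Finset.sum_filter]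
      refine Finset.sum_congr rfl fun x _ => ?_
      by_cases hx : x ∈ X
      · simp only [hx, if_true, true_and]
        rw [← Finset.sum_filter]
        congr 1
        ext y; simp
      · simp [hx]
    simp only [h1]
    rw [Finset.sum_comm, Finset.mul_sum]
    refine Finset.sum_congr rfl fun x _ => ?_
    rw [Finset.sum_comm, ← row_sum, Finset.mul_sum]
    refine Finset.sum_congr rfl fun y _ => ?_
    by_cases hxy : x = y
    · subst hxy; simp
    · rw [← Finset.sum_filter, Finset.sum_const, count_sep x y hxy]
      simp [hxy]
  have hb : |∑ X : Finset (Fin n), ∑ x ∈ U ∩ X, ∑ y ∈ Xᶜ, dk G p x y| ≤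
      2 ^ n * (α * Real.sqrt (U.card * n) + n / p) := by
    refine (Finset.abs_sum_le_sum_abs _ _).trans ?_
    have : ∀ X ∈ (Finset.univ : Finset (Finset (Fin n))),
        |∑ x ∈ U ∩ X, ∑ y ∈ Xᶜ, dk G p x y| ≤ α * Real.sqrt (U.card * n) + n / p := by
      intro X _
      refine (disc_bound G p α hp hp1 hα hG (U ∩ X) Xᶜ ?_).trans ?_
      · rw [Finset.disjoint_left]
        intro a ha
        simp at ha ⊢
        exact ha.2
      · have h1 : ((U ∩ X).card : ℝ) ≤ U.card := by
          exact_mod_cast Finset.card_le_card Finset.inter_subset_left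
        have h2 : ((Xᶜ).card : ℝ) ≤ n := by
          have := Finset.card_le_univ Xᶜ
          simp only [Fintype.card_fin] at this
          exact_mod_cast this
        gcongr
    refine (Finset.sum_le_card_nsmul _ _ _ this).trans (le_of_eq ?_)
    rw [nsmul_eq_mul, Finset.card_univ, Fintype.card_finset, Fintype.card_fin]
    push_cast
    rfl
  rw [key, abs_mul, abs_of_pos (by positivity)] at hb
  have h4 : (2 : ℝ) ^ n = 2 ^ (n - 2) * 4 := by
    obtain ⟨m, rfl⟩ := Nat.exists_eq_add_of_le hn
    rw [show 2 + m - 2 = m by omega, pow_add]; ring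
  rw [h4, mul_assoc] at hb
  exact le_of_mul_le_mul_left hb (by positivity)

lemma final_num (A ε p N u : ℝ) (hA : 2 ≤ A) (hε : 0 < ε) (hε1 : ε < 1) (hp : 0 < p)
    (hp1 : p < 1) (hN : 0 < N) (hC : A ^ 2 * 1000 ≤ ε ^ 3 * N * p ^ 2) (hu : ε * N / 2 < u)
    (h : u * (ε * N * p - p) ≤ 4 * (A * Real.sqrt (N * p) * Real.sqrt (u * N) + N / p)) :
    False := by
  have hu0 : 0 < u := lt_trans (by positivity) hu
  have hC1 : 4000 ≤ ε ^ 3 * N * p ^ 2 := by nlinarith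
  have e1 : ε ^ 3 * N * p ^ 2 ≤ ε ^ 2 * N * p ^ 2 := by
    have : ε ^ 3 ≤ ε ^ 2 := pow_le_pow_of_le_one hε.le hε1.le (by norm_num)
    gcongr
  have e2 : ε ^ 2 * N * p ^ 2 ≤ ε * N := by
    have h1 : ε ^ 2 * p ^ 2 ≤ ε := by
      have : p ^ 2 ≤ 1 := by nlinarith
      nlinarith
    nlinarith
  have e3 : ε ^ 3 * N * p ^ 2 ≤ ε ^ 3 * N * p := by
    have : p ^ 2 ≤ p := by nlinarith
    gcongr
  have hs : Real.sqrt (N * p) * Real.sqrt (u * N) = N * Real.sqrt (p * u) := by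
    rw [← Real.sqrt_mul (by positivity), show N * p * (u * N) = N ^ 2 * (p * u) by ring,
      Real.sqrt_mul (by positivity), Real.sqrt_sq hN.le]
  rw [mul_assoc A, hs] at h
  set s := Real.sqrt (p * u) with hsdef
  have hs0 : 0 < s := Real.sqrt_pos.mpr (by positivity)
  have hs2 : s ^ 2 = p * u := Real.sq_sqrt (by positivity)
  -- half
  have h1 : N * (ε * (p * u)) ≤ N * (8 * A * s + 8 / p) := by
    have : u * (ε * N * p - p) ≥ u * p * (ε * N) / 2 := by
      have : 0 < u * p := by positivity
      nlinarith
    have e : N * (8 * A * s + 8 / p) = 2 * (4 * (A * (N * s) + N / p)) := by ring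
    rw [e]; linarith
  have h2 := le_of_mul_le_mul_left h1 hN
  rw [← hs2] at h2
  have hs3 : ε * N * p / 2 < s ^ 2 := by rw [hs2]; nlinarith
  -- first term
  have t1 : 16 * A * s < ε * s ^ 2 := by
    have : 16 * A < ε * s := by
      have h3 : (16 * A) ^ 2 < (ε * s) ^ 2 := by
        have : ε ^ 2 * (ε * N * p / 2) < ε ^ 2 * s ^ 2 := by gcongr
        nlinarith
      exact lt_of_pow_lt_pow_left₀ 2 (by positivity) h3
    nlinarith
  have t2 : 16 / p < ε * s ^ 2 := by
    rw [div_lt_iff₀ hp]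
    have : ε * (ε * N * p / 2) * p < ε * s ^ 2 * p := by gcongr
    nlinarith
  have : 16 / p = 2 * (8 / p) := by ring
  linarith

theorem weakly_bijumbled_degree_concentration :
    ∃ C : ℝ, 1 < C ∧ ∀ A : ℝ, 2 ≤ A → ∀ ε p : ℝ,
      ε ∈ Set.Ioo (0 : ℝ) 1 → p ∈ Set.Ioo (0 : ℝ) 1 → ∀ n : ℕ,
      A ^ 2 * C ≤ ε ^ 3 * n * p ^ 2 →
      ∀ G : SimpleGraph (Fin n), WeaklyBijumbled G p (A * Real.sqrt (n * p)) →
        (({v : Fin n | ε * n * p < |(deg G v : ℝ) - n * p|}).ncard : ℝ) ≤ ε * n := by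
  classical
  refine ⟨1000, by norm_num, ?_⟩
  rintro A hA ε p ⟨hε, hε1⟩ ⟨hp, hp1⟩ n hC G hG
  have hN : 2 < (n : ℝ) := by
    have h1 : 4000 ≤ ε ^ 3 * n * p ^ 2 := by nlinarith
    have h2 : ε ^ 3 * p ^ 2 ≤ 1 := by
      have a : ε ^ 3 ≤ 1 := pow_le_one₀ hε.le hε1.le
      have b : p ^ 2 ≤ 1 := pow_le_one₀ hp.le hp1.le
      exact mul_le_one₀ a (by positivity) b
    have h3 : (0 : ℝ) ≤ n := by positivity
    nlinarith
  have hn2 : 2 ≤ n := by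
    have : 2 < n := by exact_mod_cast hN
    omega
  have hα : 0 ≤ A * Real.sqrt (n * p) := by positivity
  by_contra hcon
  push Not at hcon
  set P := Finset.univ.filter (fun v : Fin n => ε * n * p < (deg G v : ℝ) - n * p)
  set Q := Finset.univ.filter (fun v : Fin n => ε * n * p < n * p - (deg G v : ℝ))
  have hset : {v : Fin n | ε * n * p < |(deg G v : ℝ) - n * p|} = ((P ∪ Q : Finset _) : Set _) := by
    ext v
    simp [P, Q, lt_abs]
  rw [hset, Set.ncard_coe_finset] at hcon
  have hle : ((P ∪ Q).card : ℝ) ≤ P.card + Q.card := by exact_mod_cast Finset.card_union_le P Q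
  rcases lt_or_ge (ε * n / 2) (P.card : ℝ) with hbig | hsm
  · refine final_num A ε p n P.card hA hε hε1 hp hp1 (by linarith) hC hbig ?_
    refine le_trans ?_ (avg_bound hn2 G p _ hp hp1 hα hG P)
    refine le_trans ?_ (le_abs_self _)
    rw [← nsmul_eq_mul]
    refine Finset.card_nsmul_le_sum _ _ _ fun v hv => ?_
    have := (Finset.mem_filter.mp hv).2
    linarith
  · have hbig : ε * n / 2 < (Q.card : ℝ) := by linarith
    refine final_num A ε p n Q.card hA hε hε1 hp hp1 (by linarith) hC hbig ?_
    refine le_trans ?_ (avg_bound hn2 G p _ hp hp1 hα hG Q)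
    refine le_trans ?_ (neg_le_abs _)
    rw [← nsmul_eq_mul, ← Finset.sum_neg_distrib]
    refine Finset.card_nsmul_le_sum _ _ _ fun v hv => ?_
    have := (Finset.mem_filter.mp hv).2
    linarith
end
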